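/- arXiv:1711.09244 — 4 statements merged into one kernel-verified Lean document; each statement's English description precedes it below -/
import Mathlib

section
/- Let 𝕀 and 𝕁 be classes of bounded linear operators between real Banach spaces, each having the ideal property. If there exists an operator U that is universal for the complement of 𝕀 ∩ 𝕁 (that is, U ∉ 𝕀 ∩ 𝕁 and U factors through every operator not belonging to 𝕀 ∩ 𝕁), then 𝕀 ⊆ 𝕁 or 𝕁 ⊆ 𝕀. -/
/-!
STATEMENT 0: If `I` and `J` are classes of bounded linear operators between real Banach
spaces, each having the ideal property, and there exists an operator `U` universal for the
complement of `I ∩ J` (i.e. `U ∉ I ∩ J` and `U` factors through every operator not in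
`I ∩ J`), then `I ⊆ J` or `J ⊆ I`.
-/

/-- A bundled real Banach space. -/
structure BanachSp : Type 1 where
  carrier : Type
  [nacg : NormedAddCommGroup carrier]
  [nsp : NormedSpace ℝ carrier]
  [cs : CompleteSpace carrier]

attribute [instance] BanachSp.nacg BanachSp.nsp BanachSp.cs

/-- `A` factors through `B`: there are bounded operators `C`, `D` with `A = D ∘ B ∘ C`. -/
def FactorsThrough {X Y Z W : Type*} [NormedAddCommGroup X] [NormedSpace ℝ X]
    [NormedAddCommGroup Y] [NormedSpace ℝ Y] [NormedAddCommGroup Z] [NormedSpace ℝ Z]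
    [NormedAddCommGroup W] [NormedSpace ℝ W]
    (A : X →L[ℝ] Y) (B : Z →L[ℝ] W) : Prop :=
  ∃ (C : X →L[ℝ] Z) (D : W →L[ℝ] Y), ∀ x, D (B (C x)) = A x

/-- A class of operators between real Banach spaces: a set of bounded operators for each
pair of Banach spaces. -/
def OpClass : Type 1 :=
  ∀ X Y : BanachSp, Set (X.carrier →L[ℝ] Y.carrier)

/-- The ideal property: closed under composition with arbitrary bounded operators on
either side. -/
def HasIdealProperty (I : OpClass) : Prop :=
  ∀ (W X Y Z : BanachSp) (C : W.carrier →L[ℝ] X.carrier)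
    (B : X.carrier →L[ℝ] Y.carrier) (A : Y.carrier →L[ℝ] Z.carrier),
    B ∈ I X Y → (A.comp (B.comp C)) ∈ I W Z

theorem HasIdealProperty.mem_of_factorsThrough {I : OpClass} (hI : HasIdealProperty I)
    {E F X Y : BanachSp} {U : E.carrier →L[ℝ] F.carrier} {A : X.carrier →L[ℝ] Y.carrier}
    (hA : A ∈ I X Y) (h : FactorsThrough U A) : U ∈ I E F := by
  obtain ⟨C, D, hCD⟩ := h
  have hU : D.comp (A.comp C) = U := ContinuousLinearMap.ext hCD
  exact hU ▸ hI E X Y F C A D hA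

theorem statement0 (I J : OpClass) (hI : HasIdealProperty I) (hJ : HasIdealProperty J)
    (E F : BanachSp) (U : E.carrier →L[ℝ] F.carrier)
    (hUnot : ¬ (U ∈ I E F ∧ U ∈ J E F))
    (hUuniv : ∀ (X Y : BanachSp) (A : X.carrier →L[ℝ] Y.carrier),
      ¬ (A ∈ I X Y ∧ A ∈ J X Y) → FactorsThrough U A) :
    (∀ X Y : BanachSp, I X Y ⊆ J X Y) ∨ (∀ X Y : BanachSp, J X Y ⊆ I X Y) := by
  rcases not_and_or.mp hUnot with hU | hU
  · left
    intro X Y A hA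
    by_contra hAJ
    exact hU (hI.mem_of_factorsThrough hA (hUuniv X Y A fun h => hAJ h.2))
  · right
    intro X Y A hA
    by_contra hAI
    exact hU (hJ.mem_of_factorsThrough hA (hUuniv X Y A fun h => hAI h.1))
end

section
/- Let (E_n)_{n∈ℕ} be a sequence of finite-dimensional real normed spaces and for each n let U_n : E_n → ℓ∞ be a bounded linear operator, where ℓ∞ denotes the space of bounded real sequences with the supremum norm. Let B : X → Y be a bounded operator between real Banach spaces and suppose there is a constant c > 0 such that for every n ∈ ℕ and every closed subspace Z of X of finite codimension, U_n c-factors through the restriction B|_Z : Z → Y; that is, there exist bounded operators C : E_n → X with range contained in Z and A : Y → ℓ∞ with ‖C‖ ≤ c, ‖A‖ ≤ c and A ∘ B ∘ C = U_n. Then the direct sum operator ⊕_{n} U_n from the ℓ₁-sum (⊕_{n} E_n)_{ℓ₁} to the ℓ∞-sum (⊕_{n} ℓ∞)_{ℓ∞}, defined by (x_n)_n ↦ (U_n x_n)_n, is a bounded operator that factors through B; that is, there exist bounded operators C : (⊕_n E_n)_{ℓ₁} → X and A : Y → (⊕_n ℓ∞)_{ℓ∞} such that A(B(C x)) = (U_n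 x_n)_n for every x = (x_n)_n ∈ (⊕_n E_n)_{ℓ₁}. -/
/-!
STATEMENT 1: Let `(E n)` be finite-dimensional real normed spaces, `U n : E n → ℓ∞`
bounded operators, and `B : X → Y` a bounded operator between real Banach spaces.  Suppose
there is `c > 0` such that for every `n` and every closed finite-codimensional subspace
`Z` of `X`, the operator `U n` `c`-factors through the restriction `B|_Z`.  Then the
direct sum operator `⊕ₙ Uₙ : (⊕ₙ E n)_{ℓ₁} → (⊕ₙ ℓ∞)_{ℓ∞}` factors through `B`.
-/

open Filter

set_option synthInstance.maxHeartbeats 400000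
set_option maxHeartbeats 1000000

/-- The space `ℓ∞` of bounded real sequences with the sup norm. -/
abbrev ellInfty : Type := ↥(lp (fun _ : ℕ => ℝ) ⊤)

/-- A uniformly bounded family of operators assembles to an operator into the `ℓ∞`-sum. -/
theorem exists_clm_lp_top {ι : Type*} {V : Type*} [NormedAddCommGroup V] [NormedSpace ℝ V]
    {F : ι → Type*} [∀ i, NormedAddCommGroup (F i)] [∀ i, NormedSpace ℝ (F i)]
    (a : ∀ i, V →L[ℝ] F i) {M : ℝ} (hM : 0 ≤ M) (ha : ∀ i, ‖a i‖ ≤ M) :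
    ∃ A : V →L[ℝ] ↥(lp F ⊤), ‖A‖ ≤ M ∧ ∀ v i, (A v : ∀ i, F i) i = a i v := by
  have hb : ∀ v i, ‖a i v‖ ≤ M * ‖v‖ := fun v i => (a i).le_of_opNorm_le (ha i) v
  let L : V →ₗ[ℝ] ↥(lp F ⊤) :=
    { toFun := fun v => ⟨fun i => a i v,
        memℓp_infty ⟨M * ‖v‖, by rintro _ ⟨i, rfl⟩; exact hb v i⟩⟩
      map_add' := fun v w => by
        ext i
        exact (a i).map_add v w
      map_smul' := fun r v => by
        ext i
        exact (a i).map_smul r v }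
  exact ⟨L.mkContinuous M fun v => lp.norm_le_of_forall_le (by positivity) fun i => hb v i,
    LinearMap.mkContinuous_norm_le _ hM _, fun v i => rfl⟩

/-- A uniformly bounded family of operators assembles to an operator on the `ℓ₁`-sum. -/
theorem exists_clm_lp_one {ι : Type*} {X : Type*} [NormedAddCommGroup X] [NormedSpace ℝ X]
    [CompleteSpace X] {E : ι → Type*} [∀ i, NormedAddCommGroup (E i)] [∀ i, NormedSpace ℝ (E i)]
    (C : ∀ i, E i →L[ℝ] X) {M : ℝ} (hC : ∀ i, ‖C i‖ ≤ M) :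
    ∃ T : ↥(lp E 1) →L[ℝ] X, ∀ x, HasSum (fun i => C i (x i)) (T x) := by
  have hx : ∀ x : ↥(lp E 1), HasSum (fun i => ‖x i‖) ‖x‖ := fun x => by
    simpa using lp.hasSum_norm (p := 1) (by simp) x
  have hb : ∀ (x : ↥(lp E 1)) i, ‖C i (x i)‖ ≤ M * ‖x i‖ := fun x i =>
    (C i).le_of_opNorm_le (hC i) (x i)
  have hs : ∀ x : ↥(lp E 1), Summable fun i => C i (x i) := fun x =>
    .of_norm_bounded ((hx x).summable.mul_left M) (hb x)
  let L : ↥(lp E 1) →ₗ[ℝ] X :=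
    { toFun := fun x => ∑' i, C i (x i)
      map_add' := fun x y => by
        rw [← (hs x).tsum_add (hs y)]
        simp
      map_smul' := fun r x => by
        simp [(hs x).tsum_const_smul] }
  exact ⟨L.mkContinuous M fun x => tsum_of_norm_bounded ((hx x).mul_left M) (hb x),
    fun x => (hs x).hasSum⟩

/-- The Hahn–Banach theorem for operators into `ℓ∞`. -/
theorem exists_extension_ellInfty {P V : Type*} [AddCommGroup P] [Module ℝ P]
    [NormedAddCommGroup V] [NormedSpace ℝ V] (j : P →ₗ[ℝ] V) (φ : P →ₗ[ℝ] ellInfty)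
    {M : ℝ} (hM : 0 ≤ M) (h : ∀ p, ‖φ p‖ ≤ M * ‖j p‖) :
    ∃ A : V →L[ℝ] ellInfty, ‖A‖ ≤ M ∧ ∀ p, A (j p) = φ p := by
  obtain ⟨s, hs⟩ := j.rangeRestrict.exists_rightInverse_of_surjective j.range_rangeRestrict
  have hjs : ∀ v, j (s v) = v := fun v => congrArg Subtype.val (LinearMap.congr_fun hs v)
  have hφ : ∀ p, φ (s (j.rangeRestrict p)) = φ p := fun p => by
    rw [← sub_eq_zero, ← map_sub, ← norm_le_zero_iff]
    refine (h _).trans ?_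
    simp [hjs]
  let ψ : LinearMap.range j →L[ℝ] ellInfty :=
    (φ ∘ₗ s).mkContinuous M fun v => by simpa [hjs] using h (s v)
  have hψ : ‖ψ‖ ≤ M := LinearMap.mkContinuous_norm_le _ hM _
  have hcoord : ∀ i : ℕ, ∃ a : V →L[ℝ] ℝ, (∀ p, a (j p) = φ p i) ∧ ‖a‖ ≤ M := fun i => by
    let f : LinearMap.range j →L[ℝ] ℝ := (lp.evalCLM ℝ (fun _ : ℕ => ℝ) ⊤ i).comp ψ
    obtain ⟨a, ha, hn⟩ := exists_extension_norm_eq (LinearMap.range j) f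
    refine ⟨a, fun p => ?_, hn.le.trans ?_⟩
    · rw [← hφ]
      exact ha (j.rangeRestrict p)
    · refine f.opNorm_le_bound hM fun v => ?_
      exact (lp.norm_apply_le_norm ENNReal.top_ne_zero (ψ v) i).trans (ψ.le_of_opNorm_le hψ v)
  choose a ha hn using hcoord
  obtain ⟨A, hA, hAa⟩ := exists_clm_lp_top a hM hn
  exact ⟨A, hA, fun p => by ext i; rw [hAa, ha]⟩

/-- A finite-dimensional subspace is normed up to a factor `2` by finitely many functionals. -/
theorem exists_finite_norming.{v} {V : Type v} [NormedAddCommGroup V] [NormedSpace ℝ V]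
    (G : Submodule ℝ V) [FiniteDimensional ℝ G] :
    ∃ (ι : Type v) (_ : Fintype ι) (T : V →L[ℝ] (ι → ℝ)),
      (∀ v, ‖T v‖ ≤ ‖v‖) ∧ ∀ g ∈ G, ‖g‖ ≤ 2 * ‖T g‖ := by
  have : ProperSpace G := FiniteDimensional.proper_real G
  obtain ⟨t, hts, hfin, ht⟩ :=
    (isCompact_sphere (0 : G) 1).finite_cover_balls (e := 1 / 2) (by norm_num)
  choose f hf1 hf using fun v : V => exists_dual_vector'' ℝ v
  have := hfin.fintype
  refine ⟨t, inferInstance, ContinuousLinearMap.pi fun x : t => f (x : G), fun v => ?_,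
    fun g hg => ?_⟩
  · refine (pi_norm_le_iff_of_nonneg (norm_nonneg v)).2 fun x => ?_
    simpa using (f (x : G)).le_of_opNorm_le (hf1 _) v
  · rcases eq_or_ne g 0 with rfl | h0
    · simp
    have hpos : 0 < ‖g‖ := norm_pos_iff.2 h0
    let u : G := ‖g‖⁻¹ • ⟨g, hg⟩
    have hu : u ∈ Metric.sphere (0 : G) 1 := by
      simp [u, norm_smul, hpos.ne']
    obtain ⟨x, hxt, hx⟩ := Set.mem_iUnion₂.1 (ht hu)
    have hxu : ‖(x : V) - u‖ < 1 / 2 := by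
      rw [Metric.mem_ball, dist_comm, dist_eq_norm] at hx
      exact_mod_cast hx
    have h1 : f x ((x : V) - u) ≤ ‖(x : V) - u‖ :=
      (le_abs_self _).trans (by simpa using (f x).le_of_opNorm_le (hf1 _) ((x : V) - u))
    have hfx : f x (x : V) = 1 := (hf x).trans (by simpa using hts hxt)
    have h4 : ‖f x g‖ ≤ ‖ContinuousLinearMap.pi (fun x : t => f (x : G)) g‖ :=
      norm_le_pi_norm (ContinuousLinearMap.pi (fun x : t => f (x : G)) g) ⟨x, hxt⟩
    have h5 : f x (u : V) = ‖g‖⁻¹ * f x g := by simp [u]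
    have h6 : 1 / 2 ≤ ‖g‖⁻¹ * f x g := by
      rw [map_sub] at h1
      linarith
    have h7 : ‖g‖ / 2 ≤ f x g := by
      have := mul_le_mul_of_nonneg_left h6 hpos.le
      rw [mul_inv_cancel_left₀ hpos.ne'] at this
      linarith
    have h8 := le_abs_self (f x g)
    rw [Real.norm_eq_abs] at h4
    linarith

/-- Operators into `ℓ∞` defined on a finite-dimensional space have finite-rank extensions. -/
theorem exists_finite_rank_extension_ellInfty {P V : Type*} [AddCommGroup P] [Module ℝ P]
    [FiniteDimensional ℝ P] [NormedAddCommGroup V] [NormedSpace ℝ V]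
    (j : P →ₗ[ℝ] V) (φ : P →ₗ[ℝ] ellInfty)
    {M : ℝ} (hM : 0 ≤ M) (h : ∀ p, ‖φ p‖ ≤ M * ‖j p‖) :
    ∃ A : V →L[ℝ] ellInfty, ‖A‖ ≤ M * 2 ∧ (∀ p, A (j p) = φ p) ∧
      A.toLinearMap.HasFiniteRange := by
  obtain ⟨ι, _, T, hT, hTG⟩ := exists_finite_norming (LinearMap.range j)
  obtain ⟨S, hS, hSφ⟩ := exists_extension_ellInfty (T.toLinearMap ∘ₗ j) φ
    (M := M * 2) (by positivity) fun p => by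
      have := mul_le_mul_of_nonneg_left (hTG (j p) ⟨p, rfl⟩) hM
      rw [mul_assoc]
      exact (h p).trans this
  refine ⟨S.comp T, ?_, hSφ, ?_⟩
  · refine ContinuousLinearMap.opNorm_le_bound _ (by positivity) fun v => ?_
    exact (S.le_of_opNorm_le hS (T v)).trans (by gcongr; exact hT v)
  · rw [← LinearMap.ker_coFG_iff_hasFiniteRange]
    refine Submodule.CoFG.of_le (S := LinearMap.ker T.toLinearMap) ?_ (.ker _)
    intro v hv
    have : T v = 0 := hv
    simp [this]

/-- If `U` `c`-factors through the restrictions of `B` to all closed finite-codimensional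
subspaces, then the left factor can be chosen of finite rank and vanishing on a prescribed
finite-dimensional subspace. -/
theorem exists_finite_rank_factorization {E X Y : Type*}
    [NormedAddCommGroup E] [NormedSpace ℝ E] [FiniteDimensional ℝ E]
    [NormedAddCommGroup X] [NormedSpace ℝ X] [NormedAddCommGroup Y] [NormedSpace ℝ Y]
    (U : E →L[ℝ] ellInfty) (B : X →L[ℝ] Y) {c : ℝ} (hc : 0 ≤ c)
    (hfact : ∀ Z : Submodule ℝ X, IsClosed (Z : Set X) → FiniteDimensional ℝ (X ⧸ Z) →
      ∃ (C : E →L[ℝ] X) (A : Y →L[ℝ] ellInfty),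
        (∀ e, C e ∈ Z) ∧ ‖C‖ ≤ c ∧ ‖A‖ ≤ c ∧ ∀ e, A (B (C e)) = U e)
    (Z : Submodule ℝ X) (hZ : IsClosed (Z : Set X)) (hZfin : FiniteDimensional ℝ (X ⧸ Z))
    (G : Submodule ℝ Y) [FiniteDimensional ℝ G] :
    ∃ (C : E →L[ℝ] X) (A : Y →L[ℝ] ellInfty),
      (∀ e, C e ∈ Z) ∧ ‖C‖ ≤ c ∧ ‖A‖ ≤ c * 3 * 2 ∧ (∀ e, A (B (C e)) = U e) ∧
      (∀ g ∈ G, A g = 0) ∧ A.toLinearMap.HasFiniteRange := by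
  obtain ⟨ι, _, T, hT, hTG⟩ := exists_finite_norming G
  obtain ⟨C, A, hCZ, hC, hA, hU⟩ := hfact (Z ⊓ LinearMap.ker (T.comp B).toLinearMap)
    (hZ.inter (T.comp B).isClosed_ker) (Submodule.CoFG.inf hZfin (.ker _))
  let j : G × E →ₗ[ℝ] Y := G.subtype.coprod (B.comp C).toLinearMap
  obtain ⟨A', hA', hj, hfin⟩ := exists_finite_rank_extension_ellInfty j
    (U.toLinearMap ∘ₗ LinearMap.snd ℝ G E) (M := c * 3) (by positivity) <| by
      rintro ⟨g, e⟩
      have hTe : T (B (C e)) = 0 := (hCZ e).2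
      have hjeq : j (g, e) = g + B (C e) := by simp [j]
      have h1 : ‖T (g : Y)‖ ≤ ‖j (g, e)‖ := by
        have := hT (j (g, e))
        rwa [hjeq, map_add, hTe, add_zero, ← hjeq] at this
      have h2 := hTG g g.2
      have h3 : ‖B (C e)‖ ≤ ‖j (g, e)‖ + ‖(g : Y)‖ := by
        simpa [hjeq] using norm_sub_le (j (g, e)) (g : Y)
      have h4 : ‖B (C e)‖ ≤ 3 * ‖j (g, e)‖ := by linarith
      change ‖U e‖ ≤ _
      rw [← hU, mul_assoc]
      exact (A.le_of_opNorm_le hA _).trans (by gcongr)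
  refine ⟨C, A', fun e => (hCZ e).1, hC, hA', fun e => ?_, fun g hg => ?_, hfin⟩
  · simpa [j] using hj (0, e)
  · simpa [j] using hj (⟨g, hg⟩, 0)

/-- If each `U n` `c`-factors through the restrictions of `B` to all closed finite-codimensional
subspaces, then the factorizations can be chosen biorthogonal. -/
theorem exists_biorthogonal_factorization
    {E : ℕ → Type*} [∀ n, NormedAddCommGroup (E n)] [∀ n, NormedSpace ℝ (E n)]
    [∀ n, FiniteDimensional ℝ (E n)] {X Y : Type*}
    [NormedAddCommGroup X] [NormedSpace ℝ X] [NormedAddCommGroup Y] [NormedSpace ℝ Y]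
    (U : ∀ n, E n →L[ℝ] ellInfty) (B : X →L[ℝ] Y) {c : ℝ} (hc : 0 ≤ c)
    (hfact : ∀ (n : ℕ) (Z : Submodule ℝ X), IsClosed (Z : Set X) →
      FiniteDimensional ℝ (X ⧸ Z) →
      ∃ (C : E n →L[ℝ] X) (A : Y →L[ℝ] ellInfty),
        (∀ e, C e ∈ Z) ∧ ‖C‖ ≤ c ∧ ‖A‖ ≤ c ∧ ∀ e, A (B (C e)) = U n e) :
    ∃ (C : ∀ n, E n →L[ℝ] X) (A : ℕ → Y →L[ℝ] ellInfty),
      (∀ n, ‖C n‖ ≤ c) ∧ (∀ n, ‖A n‖ ≤ c * 3 * 2) ∧ (∀ n e, A n (B (C n e)) = U n e) ∧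
      ∀ m n, m ≠ n → ∀ e, A m (B (C n e)) = 0 := by
  let State := {p : Submodule ℝ X × Submodule ℝ Y //
    IsClosed (p.1 : Set X) ∧ FiniteDimensional ℝ (X ⧸ p.1) ∧ FiniteDimensional ℝ p.2}
  have step : ∀ (n : ℕ) (s : State), ∃ (C : E n →L[ℝ] X) (A : Y →L[ℝ] ellInfty),
      (∀ e, C e ∈ s.1.1) ∧ ‖C‖ ≤ c ∧ ‖A‖ ≤ c * 3 * 2 ∧ (∀ e, A (B (C e)) = U n e) ∧
      (∀ g ∈ s.1.2, A g = 0) ∧ A.toLinearMap.HasFiniteRange := fun n s => by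
    have := s.2.2.2
    exact exists_finite_rank_factorization (U n) B hc (hfact n) s.1.1 s.2.1 s.2.2.1 s.1.2
  choose C A hCZ hC hA hU hAG hfin using step
  let next : ∀ (_ : ℕ) (_ : State), State := fun n s =>
    ⟨(s.1.1 ⊓ LinearMap.ker ((A n s).comp B).toLinearMap,
      s.1.2 ⊔ LinearMap.range (B.comp (C n s)).toLinearMap),
      s.2.1.inter ((A n s).comp B).isClosed_ker,
      Submodule.CoFG.inf s.2.2.1 <| LinearMap.ker_coFG_iff_hasFiniteRange.2 <|
        (hfin n s).comp_right B.toLinearMap,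
      by
        have := s.2.2.2
        exact Submodule.finiteDimensional_sup _ _⟩
  let s : ℕ → State := fun n => Nat.rec
    ⟨(⊤, ⊥), isClosed_univ, inferInstance, inferInstance⟩ (fun n s => next n s) n
  have hZ : Antitone fun n => (s n).1.1 := antitone_nat_of_succ_le fun n => inf_le_left
  have hG : Monotone fun n => (s n).1.2 := monotone_nat_of_le_succ fun n => le_sup_left
  refine ⟨fun n => C n (s n), fun n => A n (s n), fun n => hC _ _, fun n => hA _ _,
    fun n => hU _ _, fun m n hmn e => ?_⟩
  rcases hmn.lt_or_gt with h | h
  · have h1 : C n (s n) e ∈ (s (m + 1)).1.1 := hZ (Nat.succ_le_of_lt h) (hCZ n (s n) e)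
    exact h1.2
  · refine hAG m (s m) _ (hG (Nat.succ_le_of_lt h) ?_)
    exact Submodule.mem_sup_right ⟨e, rfl⟩

theorem statement1
    (E : ℕ → Type) [∀ n, NormedAddCommGroup (E n)] [∀ n, NormedSpace ℝ (E n)]
    [∀ n, FiniteDimensional ℝ (E n)]
    (U : ∀ n, E n →L[ℝ] ellInfty)
    {X Y : Type} [NormedAddCommGroup X] [NormedSpace ℝ X] [CompleteSpace X]
    [NormedAddCommGroup Y] [NormedSpace ℝ Y] [CompleteSpace Y]
    (B : X →L[ℝ] Y) (c : ℝ) (hc : 0 < c)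
    (hfact : ∀ (n : ℕ) (Z : Submodule ℝ X), IsClosed (Z : Set X) →
      FiniteDimensional ℝ (X ⧸ Z) →
      ∃ (C : E n →L[ℝ] X) (A : Y →L[ℝ] ellInfty),
        (∀ e, C e ∈ Z) ∧ ‖C‖ ≤ c ∧ ‖A‖ ≤ c ∧ ∀ e, A (B (C e)) = U n e) :
    ∃ (C : ↥(lp E 1) →L[ℝ] X) (A : Y →L[ℝ] ↥(lp (fun _ : ℕ => ellInfty) ⊤)),
      ∀ (x : ↥(lp E 1)) (n : ℕ), (A (B (C x)) : ∀ _ : ℕ, ellInfty) n = U n (x n) := by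
  obtain ⟨C, A, hC, hA, hU, hCA⟩ := exists_biorthogonal_factorization U B hc.le hfact
  obtain ⟨C', hC'⟩ := exists_clm_lp_one C hC
  obtain ⟨A', -, hA'⟩ := exists_clm_lp_top A (by positivity) hA
  refine ⟨C', A', fun x n => ?_⟩
  rw [hA']
  have h1 : HasSum (fun i => A n (B (C i (x i)))) (A n (B (C' x))) :=
    ((A n).comp B).hasSum (hC' x)
  have h2 := hasSum_single (f := fun i => A n (B (C i (x i)))) n
    fun i hi => hCA n i hi.symm (x i)
  rw [h1.unique h2, hU]
end

section
/- Let B : X → Y be a bounded operator between real Banach spaces and suppose that B factors through every operator between Banach spaces that is not strictly singular. Then B is S₁-strictly singular; that is, either X is finite dimensional, or for every normalized basic sequence (x_n) in X and every ε > 0 there exist indices n_1 < n_2 < ⋯ < n_ℓ with {n_1, …, n_ℓ} ∈ S₁ and scalars a_1, …, a_ℓ, not all zero, such that ‖∑_{i=1}^ℓ a_i B x_{n_i}‖ < ε ‖∑_{i=1}^ℓ a_i x_{n_i}‖. -/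
/-- An operator is strictly singular if its restriction to every infinite-dimensional
closed subspace fails to be an isomorphic embedding. -/
def StrictlySingular {X Y : Type*} [NormedAddCommGroup X] [NormedSpace ℝ X]
    [NormedAddCommGroup Y] [NormedSpace ℝ Y] (A : X →L[ℝ] Y) : Prop :=
  ∀ Z : Submodule ℝ X, IsClosed (Z : Set X) → ¬ FiniteDimensional ℝ Z →
    ¬ ∃ δ : ℝ, 0 < δ ∧ ∀ z ∈ Z, δ * ‖z‖ ≤ ‖A z‖

/-- The Schreier family `S₁` (0-based indexing): the empty set together with all finite
`F ⊆ ℕ` with `|F| ≤ min F + 1`. -/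
def SchreierOne (F : Finset ℕ) : Prop :=
  F = ∅ ∨ ∃ h : F.Nonempty, F.card ≤ F.min' h + 1

/-- `(x n)` is a normalized basic sequence. -/
def NormalizedBasic {X : Type*} [NormedAddCommGroup X] [NormedSpace ℝ X] (x : ℕ → X) : Prop :=
  (∀ n, ‖x n‖ = 1) ∧
    ∃ K : ℝ, 1 ≤ K ∧ ∀ m n : ℕ, m ≤ n → ∀ a : ℕ → ℝ,
      ‖∑ i ∈ Finset.range m, a i • x i‖ ≤ K * ‖∑ i ∈ Finset.range n, a i • x i‖

open Filter Topology
open scoped ZeroAtInfty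

/-- A real vector space with a linear map to `ℕ → ℝ` hitting all unit vectors is
infinite dimensional. -/
lemma not_finiteDimensional_of_single_mem_range {E : Type*} [AddCommGroup E] [Module ℝ E]
    (T : E →ₗ[ℝ] ℕ → ℝ) (hT : ∀ n, ∃ e, T e = Pi.single n 1) : ¬ FiniteDimensional ℝ E := by
  intro _
  choose e he using hT
  have h : LinearIndependent ℝ (T ∘ e) := by
    have : T ∘ e = fun n => Pi.single n (1 : ℝ) := funext he
    rw [this]
    exact Pi.linearIndependent_single_one ℕ ℝ
  have := (LinearIndependent.of_comp T h).finite
  exact not_finite ℕ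

lemma not_finiteDimensional_lp_one : ¬ FiniteDimensional ℝ (lp (fun _ : ℕ => ℝ) 1) := by
  refine not_finiteDimensional_of_single_mem_range
    { toFun := fun f => (f : ℕ → ℝ), map_add' := fun _ _ => rfl, map_smul' := fun _ _ => rfl }
    fun n => ⟨lp.single 1 n 1, ?_⟩
  exact lp.coeFn_single 1 n 1

lemma not_finiteDimensional_zeroAtInfty : ¬ FiniteDimensional ℝ C₀(ℕ, ℝ) := by
  refine not_finiteDimensional_of_single_mem_range
    { toFun := fun f => (f : ℕ → ℝ), map_add' := fun _ _ => rfl, map_smul' := fun _ _ => rfl }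
    fun n => ⟨⟨⟨(Pi.single n 1 : ℕ → ℝ), continuous_of_discreteTopology⟩, ?_⟩, rfl⟩
  rw [cocompact_eq_cofinite]
  refine tendsto_const_nhds.congr' ?_
  filter_upwards [(Set.finite_singleton n).compl_mem_cofinite] with i hi
  exact (Pi.single_eq_of_ne (M := fun _ : ℕ => ℝ) hi 1).symm

lemma not_strictlySingular_id {Z : Type*} [NormedAddCommGroup Z] [NormedSpace ℝ Z]
    (hZ : ¬ FiniteDimensional ℝ Z) : ¬ StrictlySingular (ContinuousLinearMap.id ℝ Z) := by
  intro h
  refine h ⊤ isClosed_univ (fun hfin => hZ ?_) ⟨1, one_pos, fun z _ => by simp⟩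
  exact Module.Finite.equiv (Submodule.topEquiv (R := ℝ) (M := Z))

/-- A coordinatewise null sequence in `ℓ¹` is asymptotically disjoint from any fixed vector. -/
lemma lp_one_eventually_norm_add_ge {t : ℕ → lp (fun _ : ℕ => ℝ) 1}
    (ht : ∀ i, Tendsto (fun n => t n i) atTop (𝓝 0)) {c c' : ℝ} (hc : c' < c)
    (hn : ∀ᶠ n in atTop, c ≤ ‖t n‖) (z : lp (fun _ : ℕ => ℝ) 1) :
    ∀ᶠ n in atTop, ‖z‖ + c' ≤ ‖z + t n‖ := by
  have hnorm (f : lp (fun _ : ℕ => ℝ) 1) : HasSum (fun i => |f i|) ‖f‖ := by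
    simpa using lp.hasSum_norm (p := 1) (by simp) f
  have hlim : Tendsto (fun n => ∑' i, min |z i| |t n i|) atTop (𝓝 (∑' _ : ℕ, (0 : ℝ))) := by
    refine tendsto_tsum_of_dominated_convergence (hnorm z).summable (fun i => ?_)
      (Eventually.of_forall fun n i => ?_)
    · have h := (tendsto_const_nhds (x := |z i|)).min (ht i).abs
      simpa using h
    · rw [Real.norm_of_nonneg (by positivity)]
      exact min_le_left _ _
  rw [tsum_zero] at hlim
  filter_upwards [hn, hlim.eventually (gt_mem_nhds (half_pos (sub_pos.2 hc)))] with n h1 h2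
  have hs : Summable fun i => min |z i| |t n i| :=
    (hnorm z).summable.of_nonneg_of_le (fun i => by positivity) fun i => min_le_left _ _
  have h3 := hasSum_le (fun i => ?_) (((hnorm z).add (hnorm (t n))).sub (hs.hasSum.mul_left 2))
    (hnorm (z + t n))
  · linarith
  · have e : (z + t n) i = z i + t n i := rfl
    rw [e]
    rcases min_cases |z i| |t n i| with ⟨h, -⟩ | ⟨h, -⟩ <;> rw [h]
    · have := abs_sub_abs_le_abs_sub (t n i) (-z i)
      rw [abs_neg, sub_neg_eq_add, add_comm (t n i)] at this
      linarith
    · have := abs_sub_abs_le_abs_sub (z i) (-t n i)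
      rw [abs_neg, sub_neg_eq_add] at this
      linarith

/-- Adding far terms of a coordinatewise null sequence in `c₀` does not leave an open ball. -/
lemma zeroAtInfty_eventually_norm_add_lt {t : ℕ → C₀(ℕ, ℝ)}
    (ht : ∀ i, Tendsto (fun n => t n i) atTop (𝓝 0)) {M r : ℝ} (hM : M < r)
    (hn : ∀ n, ‖t n‖ ≤ M) {z : C₀(ℕ, ℝ)} (hz : ‖z‖ < r) :
    ∀ᶠ n in atTop, ‖z + t n‖ < r := by
  have happ (f : C₀(ℕ, ℝ)) (i : ℕ) : |f i| ≤ ‖f‖ := f.toBCF.norm_coe_le_norm i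
  obtain ⟨ρ, hρ, hρr⟩ := exists_between (max_lt hM hz)
  obtain ⟨hMρ, hzρ⟩ := max_lt_iff.1 hρ
  have hM0 : 0 ≤ M := (norm_nonneg _).trans (hn 0)
  have hfin : {i | ¬ |z i| < ρ - M}.Finite := by
    have h := (zero_at_infty z).abs
    rw [cocompact_eq_cofinite, abs_zero] at h
    exact h.eventually (gt_mem_nhds (sub_pos.2 hMρ))
  have hev : ∀ᶠ n in atTop, ∀ i ∈ {i | ¬ |z i| < ρ - M}, |t n i| < ρ - ‖z‖ := by
    rw [eventually_all_finite hfin]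
    intro i _
    have h := (ht i).abs
    rw [abs_zero] at h
    exact h.eventually (gt_mem_nhds (sub_pos.2 hzρ))
  filter_upwards [hev] with n h
  refine lt_of_le_of_lt ?_ hρr
  rw [← ZeroAtInftyContinuousMap.norm_toBCF_eq_norm]
  refine (BoundedContinuousFunction.norm_le (by linarith)).2 fun i => ?_
  refine (abs_add_le (z i) (t n i)).trans ?_
  by_cases hi : |z i| < ρ - M
  · linarith [(happ (t n) i).trans (hn n)]
  · linarith [h i hi, happ z i]

/-- Bounded families of real sequences have coordinatewise convergent subsequences. -/
lemma exists_subseq_tendsto_coord {ι : Type*} [Countable ι] {M : ℝ} (s : ℕ → ι → ℝ)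
    (hs : ∀ n i, |s n i| ≤ M) :
    ∃ φ : ℕ → ℕ, StrictMono φ ∧ ∀ i, ∃ l, Tendsto (fun n => s (φ n) i) atTop (𝓝 l) := by
  obtain ⟨l, -, φ, hφ, h⟩ := (isCompact_univ_pi fun _ : ι =>
    isCompact_Icc (a := -M) (b := M)).tendsto_subseq (x := s)
    fun n i _ => abs_le.1 (hs n i)
  exact ⟨φ, hφ, fun i => ⟨l i, tendsto_pi_nhds.1 h i⟩⟩

/-- Given coordinatewise null sequences in `ℓ¹` and `c₀`, there are sums over large sets of
large indices whose `ℓ¹` norm grows linearly while the `c₀` norm stays bounded. -/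
lemma exists_finset_norm_sum {t : ℕ → lp (fun _ : ℕ => ℝ) 1} {w : ℕ → C₀(ℕ, ℝ)}
    (ht : ∀ i, Tendsto (fun n => t n i) atTop (𝓝 0))
    (hw : ∀ i, Tendsto (fun n => w n i) atTop (𝓝 0)) {c c' M r : ℝ} (hc : c' < c)
    (htn : ∀ᶠ n in atTop, c ≤ ‖t n‖) (hM : M < r) (hwn : ∀ n, ‖w n‖ ≤ M) (m N : ℕ) :
    ∃ s : Finset ℕ, s.card = N ∧ (∀ n ∈ s, m ≤ n) ∧ N * c' ≤ ‖∑ n ∈ s, t n‖ ∧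
      ‖∑ n ∈ s, w n‖ < r := by
  induction N with
  | zero => 
    have hr : 0 < r := ((norm_nonneg _).trans (hwn 0)).trans_lt hM
    exact ⟨∅, by simp, by simp, by simp, by simpa using hr⟩
  | succ N ih =>
    obtain ⟨s, hcard, hm, h1, h2⟩ := ih
    obtain ⟨n, hn1, hn2, hnm, hns⟩ := ((lp_one_eventually_norm_add_ge ht hc htn
      (∑ n ∈ s, t n)).and ((zeroAtInfty_eventually_norm_add_lt hw hM hwn h2).and
      ((eventually_ge_atTop m).and (eventually_gt_atTop (s.sup id))))).exists
    have hnot : n ∉ s := fun h => hns.not_ge (Finset.le_sup (f := id) h)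
    refine ⟨insert n s, by simp [hnot, hcard], ?_, ?_, ?_⟩
    · simpa using ⟨hnm, hm⟩
    · rw [Finset.sum_insert hnot, add_comm (t n)]
      push_cast
      linarith
    · rwa [Finset.sum_insert hnot, add_comm (w n)]

/-- A sum of differences of consecutive terms of a subsequence, with few terms compared to the
indices, is a combination supported on a Schreier set. -/
lemma exists_schreierOne_sum_eq {X : Type*} [AddCommGroup X] [Module ℝ X] (x : ℕ → X)
    {φ : ℕ → ℕ} (hφ : StrictMono φ) {s : Finset ℕ} (hs : s.Nonempty)
    (hcard : ∀ n ∈ s, s.card ≤ n) :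
    ∃ F : Finset ℕ, SchreierOne F ∧ ∃ a : ℕ → ℝ, (∃ i ∈ F, a i ≠ 0) ∧
      ∑ i ∈ F, a i • x i = ∑ n ∈ s, (x (φ (2 * n)) - x (φ (2 * n + 1))) := by
  classical
  set P := s.image fun n => φ (2 * n) with hP
  set Q := s.image fun n => φ (2 * n + 1) with hQ
  have hPQ : Disjoint P Q := by
    rw [Finset.disjoint_left]
    intro i hi hj
    obtain ⟨n, -, rfl⟩ := Finset.mem_image.1 hi
    obtain ⟨k, -, hk⟩ := Finset.mem_image.1 hj
    have := hφ.injective hk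
    omega
  obtain ⟨n₀, hn₀⟩ := hs
  have hmem : φ (2 * n₀) ∈ P := Finset.mem_image_of_mem _ hn₀
  have hne : (P ∪ Q).Nonempty := ⟨_, Finset.mem_union_left _ hmem⟩
  refine ⟨P ∪ Q, Or.inr ⟨hne, ?_⟩, fun i => if i ∈ P then 1 else -1,
    ⟨_, Finset.mem_union_left _ hmem, by simp [hmem]⟩, ?_⟩
  · have h1 : (P ∪ Q).card ≤ 2 * s.card := by
      have := Finset.card_union_le P Q
      have : P.card ≤ s.card := Finset.card_image_le
      have : Q.card ≤ s.card := Finset.card_image_le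
      omega
    have h2 : 2 * s.card ≤ (P ∪ Q).min' hne := by
      refine Finset.le_min' _ _ _ fun i hi => ?_
      rcases Finset.mem_union.1 hi with hi | hi <;>
      · obtain ⟨n, hn, rfl⟩ := Finset.mem_image.1 hi
        have := hcard n hn
        refine le_trans ?_ (hφ.id_le _)
        simp only [id]
        omega
    omega
  · rw [Finset.sum_union hPQ, Finset.sum_sub_distrib, sub_eq_add_neg]
    congr 1
    · rw [Finset.sum_congr rfl (g := x) fun i hi => by simp [hi], hP, Finset.sum_image]
      intro a _ b _ h
      have := hφ.injective h
      omega
    · rw [Finset.sum_congr rfl (g := fun i => -x i)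
        fun i hi => by simp [Finset.disjoint_right.1 hPQ hi], hQ, Finset.sum_image,
        Finset.sum_neg_distrib]
      intro a _ b _ h
      have := hφ.injective h
      omega

/-- Terms of a normalized basic sequence are uniformly separated. -/
lemma NormalizedBasic.exists_separated {X : Type*} [NormedAddCommGroup X] [NormedSpace ℝ X]
    {x : ℕ → X} (hx : NormalizedBasic x) :
    ∃ K : ℝ, 1 ≤ K ∧ ∀ p q, p < q → 1 ≤ K * ‖x p - x q‖ := by
  obtain ⟨hnorm, K, hK, h⟩ := hx
  refine ⟨K, hK, fun p q hpq => ?_⟩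
  have key := h (p + 1) (q + 1) (by omega) (Pi.single p 1 - Pi.single q 1)
  have h1 : ∑ i ∈ Finset.range (p + 1), (Pi.single p 1 - Pi.single q 1 : ℕ → ℝ) i • x i = x p := by
    simp only [Pi.sub_apply, sub_smul, Finset.sum_sub_distrib, Pi.single_apply, ite_smul, one_smul,
      zero_smul, Finset.sum_ite_eq', Finset.mem_range]
    rw [if_pos (by omega), if_neg (by omega), sub_zero]
  have h2 : ∑ i ∈ Finset.range (q + 1), (Pi.single p 1 - Pi.single q 1 : ℕ → ℝ) i • x i
      = x p - x q := by
    simp only [Pi.sub_apply, sub_smul, Finset.sum_sub_distrib, Pi.single_apply, ite_smul, one_smul,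
      zero_smul, Finset.sum_ite_eq', Finset.mem_range]
    rw [if_pos (by omega), if_pos (by omega)]
  rwa [h1, h2, hnorm] at key

/-- An operator that factors through both `ℓ¹` and `c₀` is `S₁`-strictly singular. -/
lemma exists_schreierOne_norm_lt {X Y : Type*} [NormedAddCommGroup X] [NormedSpace ℝ X]
    [NormedAddCommGroup Y] [NormedSpace ℝ Y] {B : X →L[ℝ] Y}
    (h₁ : FactorsThrough B (ContinuousLinearMap.id ℝ (lp (fun _ : ℕ => ℝ) 1)))
    (h₀ : FactorsThrough B (ContinuousLinearMap.id ℝ C₀(ℕ, ℝ)))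
    {x : ℕ → X} (hx : NormalizedBasic x) {ε : ℝ} (hε : 0 < ε) :
    ∃ F : Finset ℕ, SchreierOne F ∧ ∃ a : ℕ → ℝ, (∃ i ∈ F, a i ≠ 0) ∧
      ‖∑ i ∈ F, a i • B (x i)‖ < ε * ‖∑ i ∈ F, a i • x i‖ := by
  by_contra! hno
  obtain ⟨C₁, D₁, hB₁⟩ := h₁
  obtain ⟨C₂, D₂, hB₂⟩ := h₀
  simp only [ContinuousLinearMap.id_apply] at hB₁ hB₂
  obtain ⟨K, hK, hsep⟩ := hx.exists_separated
  have hle₁ (n : ℕ) : ‖C₁ (x n)‖ ≤ ‖C₁‖ := by simpa [hx.1 n] using C₁.le_opNorm (x n)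
  have hle₂ (n : ℕ) : ‖C₂ (x n)‖ ≤ ‖C₂‖ := by simpa [hx.1 n] using C₂.le_opNorm (x n)
  obtain ⟨φ, hφ, hlim⟩ := exists_subseq_tendsto_coord (ι := ℕ ⊕ ℕ) (M := max ‖C₁‖ ‖C₂‖)
    (fun n => Sum.elim (fun i => C₁ (x n) i) (fun i => C₂ (x n) i)) (by
      rintro n (i | i)
      · exact (lp.norm_apply_le_norm one_ne_zero (C₁ (x n)) i).trans
          ((hle₁ n).trans (le_max_left _ _))
      · exact ((C₂ (x n)).toBCF.norm_coe_le_norm i).trans ((hle₂ n).trans (le_max_right _ _)))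
  set u : ℕ → X := fun n => x (φ (2 * n)) - x (φ (2 * n + 1)) with hu
  have hdiff {f : ℕ → ℝ} (hf : ∃ l, Tendsto f atTop (𝓝 l)) :
      Tendsto (fun n => f (2 * n) - f (2 * n + 1)) atTop (𝓝 0) := by
    obtain ⟨l, hl⟩ := hf
    have e : Tendsto (fun n : ℕ => 2 * n) atTop atTop :=
      tendsto_atTop_mono (fun n => by simp only [id]; omega) tendsto_id
    have o : Tendsto (fun n : ℕ => 2 * n + 1) atTop atTop :=
      tendsto_atTop_mono (fun n => by simp only [id]; omega) tendsto_id
    simpa using (hl.comp e).sub (hl.comp o)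
  have ht (i : ℕ) : Tendsto (fun n => C₁ (u n) i) atTop (𝓝 0) := by
    simpa [hu] using hdiff (hlim (Sum.inl i))
  have hw (i : ℕ) : Tendsto (fun n => C₂ (u n) i) atTop (𝓝 0) := by
    simpa [hu] using hdiff (hlim (Sum.inr i))
  have hlower {s : Finset ℕ} (hs : s.Nonempty) (hcard : ∀ n ∈ s, s.card ≤ n) :
      ε * ‖∑ n ∈ s, u n‖ ≤ ‖B (∑ n ∈ s, u n)‖ := by
    obtain ⟨F, hF, a, ha, hsum⟩ := exists_schreierOne_sum_eq x hφ hs hcard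
    rw [← hsum, map_sum]
    simpa only [map_smul] using hno F hF a ha
  have hK0 : 0 < K := by linarith
  set c := ε / (K * (‖D₁‖ + 1)) with hc
  have hc0 : 0 < c := by positivity
  have htn : ∀ᶠ n in atTop, c ≤ ‖C₁ (u n)‖ := by
    filter_upwards [eventually_ge_atTop 1] with n hn
    have h1 : 1 ≤ K * ‖u n‖ := hsep _ _ (hφ (by omega))
    have h2 : ε * ‖u n‖ ≤ ‖B (u n)‖ := by
      simpa using hlower (Finset.singleton_nonempty n) (by simpa using hn)
    have h3 : ‖B (u n)‖ ≤ (‖D₁‖ + 1) * ‖C₁ (u n)‖ := by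
      rw [← hB₁]
      refine (D₁.le_opNorm _).trans ?_
      gcongr
      linarith
    rw [hc, div_le_iff₀ (by positivity)]
    calc ε ≤ ε * (K * ‖u n‖) := le_mul_of_one_le_right hε.le h1
      _ = K * (ε * ‖u n‖) := by ring
      _ ≤ K * ((‖D₁‖ + 1) * ‖C₁ (u n)‖) := mul_le_mul_of_nonneg_left (h2.trans h3) hK0.le
      _ = _ := by ring
  have hwn (n : ℕ) : ‖C₂ (u n)‖ ≤ 2 * ‖C₂‖ := by
    rw [hu, map_sub]
    refine (norm_sub_le _ _).trans ?_
    linarith [hle₂ (φ (2 * n)), hle₂ (φ (2 * n + 1))]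
  set r := 2 * ‖C₂‖ + 1 with hr
  obtain ⟨N, hN⟩ := exists_nat_gt (‖C₁‖ * (‖D₂‖ * r) / (ε * (c / 2)))
  have hN0 : 0 < N := by
    have : (0 : ℝ) < N := lt_of_le_of_lt (by positivity) hN
    exact_mod_cast this
  obtain ⟨s, hcard, hsN, hs₁, hs₂⟩ := exists_finset_norm_sum ht hw (half_lt_self hc0) htn
    (lt_add_one (2 * ‖C₂‖)) hwn N N
  rw [← map_sum] at hs₁ hs₂
  have hlow := hlower (Finset.card_pos.1 (hcard ▸ hN0)) (fun n hn => hcard.le.trans (hsN n hn))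
  have hup : ‖B (∑ n ∈ s, u n)‖ ≤ ‖D₂‖ * r := by
    rw [← hB₂]
    refine (D₂.le_opNorm _).trans ?_
    gcongr
  rw [div_lt_iff₀ (by positivity)] at hN
  have : N * (ε * (c / 2)) ≤ ‖C₁‖ * (‖D₂‖ * r) := calc
    N * (ε * (c / 2)) = ε * (N * (c / 2)) := by ring
    _ ≤ ε * (‖C₁‖ * ‖∑ n ∈ s, u n‖) :=
      mul_le_mul_of_nonneg_left (hs₁.trans (C₁.le_opNorm _)) hε.le
    _ = ‖C₁‖ * (ε * ‖∑ n ∈ s, u n‖) := by ring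
    _ ≤ ‖C₁‖ * (‖D₂‖ * r) :=
      mul_le_mul_of_nonneg_left (hlow.trans hup) (norm_nonneg _)
  linarith

theorem statement3 (X Y : BanachSp) (B : X.carrier →L[ℝ] Y.carrier)
    (hfact : ∀ (Z W : BanachSp) (T : Z.carrier →L[ℝ] W.carrier),
      ¬ StrictlySingular T → FactorsThrough B T) :
    FiniteDimensional ℝ X.carrier ∨
      ∀ x : ℕ → X.carrier, NormalizedBasic x → ∀ ε : ℝ, 0 < ε →
        ∃ F : Finset ℕ, SchreierOne F ∧ ∃ a : ℕ → ℝ, (∃ i ∈ F, a i ≠ 0) ∧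
          ‖∑ i ∈ F, a i • B (x i)‖ < ε * ‖∑ i ∈ F, a i • x i‖ := by
  exact Or.inr fun x hx ε hε => exists_schreierOne_norm_lt
    (hfact ⟨lp (fun _ : ℕ => ℝ) 1⟩ ⟨lp (fun _ : ℕ => ℝ) 1⟩ _
      (not_strictlySingular_id not_finiteDimensional_lp_one))
    (hfact ⟨C₀(ℕ, ℝ)⟩ ⟨C₀(ℕ, ℝ)⟩ _
      (not_strictlySingular_id not_finiteDimensional_zeroAtInfty)) hx hε
end

section
/- There is no universal operator for the complement of the class of weak Banach–Saks operators: there does not exist a bounded operator U between real Banach spaces such that U is not weak Banach–Saks and U factors through every operator between Banach spaces that is not weak Banach–Saks. -/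
/-!
STATEMENT 6: There is no universal operator for the complement of the class of weak
Banach–Saks operators: there is no bounded operator `U` between real Banach spaces such
that `U` is not weak Banach–Saks and `U` factors through every operator between Banach
spaces that is not weak Banach–Saks.
-/

open Filter

/-- A sequence is weakly null if every continuous linear functional sends it to a null
sequence. -/
def WeaklyNull {X : Type*} [NormedAddCommGroup X] [NormedSpace ℝ X] (x : ℕ → X) : Prop :=
  ∀ f : X →L[ℝ] ℝ, Tendsto (fun n => f (x n)) atTop (nhds 0)

/-- An operator `A : X → Y` is weak Banach–Saks if every weakly null sequence in `X` has a
subsequence whose image under `A` is Cesàro summable (the Cesàro means converge in norm). -/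
def WeakBanachSaks {X Y : Type*} [NormedAddCommGroup X] [NormedSpace ℝ X]
    [NormedAddCommGroup Y] [NormedSpace ℝ Y] (A : X →L[ℝ] Y) : Prop :=
  ∀ x : ℕ → X, WeaklyNull x →
    ∃ φ : ℕ → ℕ, StrictMono φ ∧ ∃ y : Y,
      Tendsto (fun N : ℕ => (N : ℝ)⁻¹ • ∑ k ∈ Finset.range N, A (x (φ k)))
        atTop (nhds y)

/-- A family of finite sets is flat if every convex set of finitely supported
subprobability vectors with members supported arbitrarily far out has members which are
uniformly small on the family. -/
def IsFlat (𝓕 : Set (Finset ℕ)) : Prop :=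
  ∀ S : Set (ℕ →₀ ℝ), Convex ℝ S →
    (∀ a ∈ S, (∀ i, 0 ≤ a i) ∧ ∀ F : Finset ℕ, ∑ i ∈ F, a i ≤ 1) →
    (∀ n : ℕ, ∃ a ∈ S, ∀ i < n, a i = 0) →
    ∀ ε > 0, ∃ a ∈ S, ∀ F ∈ 𝓕, ∑ i ∈ F, a i ≤ ε

lemma convex_inter_vanish {S : Set (ℕ →₀ ℝ)} (hS : Convex ℝ S) (n : ℕ) :
    Convex ℝ {a ∈ S | ∀ i < n, a i = 0} := by
  intro a ha b hb s t hs ht hst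
  refine ⟨hS ha.1 hb.1 hs ht hst, fun i hi => ?_⟩
  simp [ha.2 i hi, hb.2 i hi]

lemma IsFlat.exists_far {𝓕 : Set (Finset ℕ)} (h : IsFlat 𝓕) {S : Set (ℕ →₀ ℝ)}
    (hS : Convex ℝ S) (hpos : ∀ a ∈ S, (∀ i, 0 ≤ a i) ∧ ∀ F : Finset ℕ, ∑ i ∈ F, a i ≤ 1)
    (hfar : ∀ n : ℕ, ∃ a ∈ S, ∀ i < n, a i = 0) (n : ℕ) {ε : ℝ} (hε : 0 < ε) :
    ∃ a ∈ S, (∀ i < n, a i = 0) ∧ ∀ F ∈ 𝓕, ∑ i ∈ F, a i ≤ ε := by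
  obtain ⟨a, ha, hF⟩ := h {a ∈ S | ∀ i < n, a i = 0} (convex_inter_vanish hS n)
    (fun a ha => hpos a ha.1)
    (fun k => by
      obtain ⟨a, ha, h0⟩ := hfar (max n k)
      exact ⟨a, ⟨ha, fun i hi => h0 i (lt_max_of_lt_left hi)⟩,
        fun i hi => h0 i (lt_max_of_lt_right hi)⟩) ε hε
  exact ⟨a, ha.1, ha.2, hF⟩

lemma IsFlat.of_subset_of_mem {𝓕 𝓗 : Set (Finset ℕ)} (h : IsFlat 𝓕)
    (hsub : ∀ F ∈ 𝓗, ∃ F' ∈ 𝓕, F ⊆ F') : IsFlat 𝓗 := by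
  intro S hS hpos hfar ε hε
  obtain ⟨a, ha, hF⟩ := h S hS hpos hfar ε hε
  refine ⟨a, ha, fun F hFH => ?_⟩
  obtain ⟨F', hF', hFF'⟩ := hsub F hFH
  exact (Finset.sum_le_sum_of_subset_of_nonneg hFF'
    fun i _ _ => (hpos a ha).1 i).trans (hF F' hF')

lemma IsFlat.union {𝓕 𝓗 : Set (Finset ℕ)} (h₁ : IsFlat 𝓕) (h₂ : IsFlat 𝓗) :
    IsFlat (𝓕 ∪ 𝓗) := by
  intro S hS hpos hfar ε hε
  obtain ⟨a, ⟨haS, ha₁⟩, ha₂⟩ := h₂ {a ∈ S | ∀ F ∈ 𝓕, ∑ i ∈ F, a i ≤ ε}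
    (by
      intro a ha b hb s t hs ht hst
      refine ⟨hS ha.1 hb.1 hs ht hst, fun F hF => ?_⟩
      have h1 := mul_le_mul_of_nonneg_left (ha.2 F hF) hs
      have h2 := mul_le_mul_of_nonneg_left (hb.2 F hF) ht
      have h3 : s * ε + t * ε = ε := by rw [← add_mul, hst, one_mul]
      simp only [Finsupp.add_apply, Finsupp.smul_apply, smul_eq_mul,
        Finset.sum_add_distrib, ← Finset.mul_sum]
      linarith)
    (fun a ha => hpos a ha.1)
    (fun n => by
      obtain ⟨a, ha, h0, hF⟩ := h₁.exists_far hS hpos hfar n hε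
      exact ⟨a, ⟨ha, hF⟩, h0⟩) ε hε
  exact ⟨a, haS, fun F hF => hF.elim (ha₁ F) (ha₂ F)⟩

lemma isFlat_singleton_empty : IsFlat {∅} := by
  intro S _ _ hfar ε hε
  obtain ⟨a, ha, -⟩ := hfar 0
  exact ⟨a, ha, by simpa using hε.le⟩

lemma IsFlat.biUnion_le {𝓕 : ℕ → Set (Finset ℕ)} (h : ∀ n, IsFlat (𝓕 n)) (n : ℕ) :
    IsFlat {F | ∃ m ≤ n, F ∈ 𝓕 m} := by
  induction n with
  | zero => exact (h 0).of_subset_of_mem fun F ⟨m, hm, hF⟩ => ⟨F, by simp_all, subset_rfl⟩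
  | succ n ih =>
    refine (ih.union (h (n + 1))).of_subset_of_mem fun F ⟨m, hm, hF⟩ => ⟨F, ?_, subset_rfl⟩
    rcases Nat.le_succ_iff.1 hm with h | rfl
    · exact Or.inl ⟨m, h, hF⟩
    · exact Or.inr hF

/-- A family is flat as soon as, for each `n`, the sets of the family with minimum `n`, with
that minimum removed, lie in a flat family. -/
lemma isFlat_of_erase_min {𝓕 : Set (Finset ℕ)} (𝓗 : ℕ → Set (Finset ℕ))
    (h𝓗 : ∀ n, IsFlat (𝓗 n))
    (h : ∀ F ∈ 𝓕, ∀ n ∈ F, (∀ i ∈ F, n ≤ i) → F.erase n ∈ 𝓗 n) : IsFlat 𝓕 := by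
  intro S hS hpos hfar ε hε
  have key : ∀ N : ℕ, ∃ c ∈ S, ∀ F ∈ 𝓕,
      (N + 1 : ℝ) * ∑ i ∈ F, c i ≤ 1 + (N + 1) * (ε / 2) := by
    intro N
    induction N with
    | zero =>
      obtain ⟨a, ha, -⟩ := hfar 0
      refine ⟨a, ha, fun F _ => ?_⟩
      have := (hpos a ha).2 F
      push_cast
      linarith
    | succ N ih =>
      obtain ⟨c, hc, hcF⟩ := ih
      obtain ⟨M, hM⟩ : ∃ M, ∀ i, M < i → c i = 0 :=
        ⟨c.support.sup id, fun i hi => by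
          by_contra hne
          exact absurd (Finset.le_sup (f := id) (Finsupp.mem_support_iff.2 hne)) (not_le.2 hi)⟩
      obtain ⟨y, hy, hy0, hyF⟩ :=
        (IsFlat.biUnion_le h𝓗 M).exists_far hS hpos hfar (M + 1) (half_pos hε)
      refine ⟨((N + 1 : ℝ) / (N + 1 + 1)) • c + ((1 : ℝ) / (N + 1 + 1)) • y,
        hS hc hy (by positivity) (by positivity) (by field_simp), fun F hF => ?_⟩
      have e : ((N + 1 : ℕ) + 1 : ℝ) * ∑ i ∈ F,
          (((N + 1 : ℝ) / (N + 1 + 1)) • c + ((1 : ℝ) / (N + 1 + 1)) • y) i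
          = (N + 1) * ∑ i ∈ F, c i + ∑ i ∈ F, y i := by
        simp only [Finsupp.add_apply, Finsupp.smul_apply, smul_eq_mul,
          Finset.sum_add_distrib, ← Finset.mul_sum]
        push_cast
        field_simp
      rw [e]
      push_cast
      rcases F.eq_empty_or_nonempty with rfl | hne
      · simp only [Finset.sum_empty, mul_zero, add_zero]
        positivity
      · set n := F.min' hne with hn
        have hnF : n ∈ F := F.min'_mem hne
        have hmin : ∀ i ∈ F, n ≤ i := fun i hi => F.min'_le i hi
        rcases le_or_gt n M with hnM | hnM
        · have h1 : ∑ i ∈ F, y i = ∑ i ∈ F.erase n, y i := by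
            rw [← Finset.add_sum_erase F _ hnF, hy0 n (by omega), zero_add]
          have h2 := hyF (F.erase n) ⟨n, hnM, h F hF n hnF hmin⟩
          have h3 := hcF F hF
          rw [h1]
          linarith
        · have h1 : ∑ i ∈ F, c i = 0 :=
            Finset.sum_eq_zero fun i hi => hM i (hnM.trans_le (hmin i hi))
          have h2 := (hpos y hy).2 F
          rw [h1]
          have : (0 : ℝ) ≤ (N + 1 + 1) * (ε / 2) := by positivity
          linarith
  obtain ⟨N, hN⟩ := exists_nat_gt (2 / ε)
  obtain ⟨c, hc, hcF⟩ := key N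
  refine ⟨c, hc, fun F hF => ?_⟩
  have h1 := hcF F hF
  have h2 : 1 ≤ (N + 1 : ℝ) * (ε / 2) := by
    rw [div_lt_iff₀ hε] at hN
    nlinarith
  have h3 : (N + 1 : ℝ) * ∑ i ∈ F, c i ≤ (N + 1) * ε := by linarith
  exact le_of_mul_le_mul_left h3 (by positivity)

/-- The Schreier family. -/
def schreier : Set (Finset ℕ) := {F | ∀ i ∈ F, F.card ≤ i + 1}

lemma isFlat_card_le (n : ℕ) : IsFlat {F | F.card ≤ n} := by
  induction n with
  | zero =>
    exact isFlat_singleton_empty.of_subset_of_mem fun F hF => ⟨∅, rfl, by simp_all⟩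
  | succ n ih =>
    refine isFlat_of_erase_min (fun _ => _) (fun _ => ih) fun F hF m hm _ => ?_
    have : F.card ≤ n + 1 := hF
    simp only [Set.mem_ofPred_eq, Finset.card_erase_of_mem hm]
    omega

lemma isFlat_schreier : IsFlat schreier := by
  refine isFlat_of_erase_min (fun n => {F | F.card ≤ n}) isFlat_card_le fun F hF m hm _ => ?_
  have := hF m hm
  simp only [Set.mem_ofPred_eq, Finset.card_erase_of_mem hm]
  omega

/-- The spreads of the extensions of a stem `s` (written with its last entry first) inside a
tree `𝓖`: sets `{n₁ < ⋯ < n_l}` for which there are `m_i ≤ n_i` such that the stem followed by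
`m₁, …, m_l` is a branch of `𝓖`. -/
inductive Spread (𝓖 : Set (List ℕ)) : List ℕ → Finset ℕ → Prop
  | empty (s : List ℕ) : Spread 𝓖 s ∅
  | insert (s : List ℕ) (m n : ℕ) (H : Finset ℕ) (hmn : m ≤ n) (hn : ∀ h ∈ H, n < h)
      (hs : m :: s ∈ 𝓖) (hH : Spread 𝓖 (m :: s) H) : Spread 𝓖 s (insert n H)

lemma min_insert_eq {F H : Finset ℕ} {n n' : ℕ} (hF : F = insert n' H)
    (hn' : ∀ h ∈ H, n' < h) (hn : n ∈ F) (hmin : ∀ i ∈ F, n ≤ i) :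
    n' = n ∧ F.erase n = H := by
  subst hF
  have h1 : n ≤ n' := hmin n' (Finset.mem_insert_self _ _)
  have h2 : n' = n := by
    rcases Finset.mem_insert.1 hn with h | h
    · exact h.symm
    · have := hn' n h
      omega
  subst h2
  exact ⟨rfl, Finset.erase_insert fun h => lt_irrefl _ (hn' _ h)⟩

lemma isFlat_spread {𝓖 : Set (List ℕ)}
    (hwf : WellFounded fun t s : List ℕ => ∃ m, t = m :: s ∧ t ∈ 𝓖) (s : List ℕ) :
    IsFlat {F | Spread 𝓖 s F} := by
  induction s using hwf.induction with
  | _ s ih =>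
    refine isFlat_of_erase_min (fun n => {H | ∃ m ≤ n, H ∈ {H | m :: s ∈ 𝓖 ∧ Spread 𝓖 (m :: s) H}})
      (IsFlat.biUnion_le fun m => ?_) fun F hF n hn hmin => ?_
    · by_cases hm : m :: s ∈ 𝓖
      · exact (ih (m :: s) ⟨m, rfl, hm⟩).of_subset_of_mem fun F hF => ⟨F, hF.2, subset_rfl⟩
      · exact isFlat_singleton_empty.of_subset_of_mem fun F hF => absurd hF.1 hm
    · rcases hF with _ | ⟨_, m, n', H, hmn, hn', hs, hH⟩
      · simp at hn
      · obtain ⟨rfl, h2⟩ := min_insert_eq rfl hn' hn hmin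
        exact ⟨m, hmn, hs, by rw [h2]; exact hH⟩

/-- The domain family attached to a sequence of trees: the Schreier sets together with all
subsets of sets `{n₀} ∪ H` with `n₀ < H` and `H` a spread of a branch of one of the trees
`𝓖 0, …, 𝓖 n₀`. -/
def domainFamily (𝓖 : ℕ → Set (List ℕ)) : Set (Finset ℕ) :=
  schreier ∪ {F | ∃ n H, F ⊆ insert n H ∧ (∀ h ∈ H, n < h) ∧ ∃ k ≤ n, Spread (𝓖 k) [] H}

lemma isFlat_domainFamily {𝓖 : ℕ → Set (List ℕ)}
    (hwf : ∀ k, WellFounded fun t s : List ℕ => ∃ m, t = m :: s ∧ t ∈ 𝓖 k) :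
    IsFlat (domainFamily 𝓖) := by
  refine isFlat_schreier.union ?_
  have : IsFlat {F | ∃ n H, F = insert n H ∧ (∀ h ∈ H, n < h) ∧
      ∃ k ≤ n, H ∈ {H | Spread (𝓖 k) [] H}} := by
    refine isFlat_of_erase_min (fun n => {H | ∃ k ≤ n, H ∈ {H | Spread (𝓖 k) [] H}})
      (IsFlat.biUnion_le fun k => isFlat_spread (hwf k) []) ?_
    rintro F ⟨n', H, hF, hn', hk⟩ n hn hmin
    obtain ⟨rfl, h2⟩ := min_insert_eq hF hn' hn hmin
    rw [h2]
    exact hk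
  exact this.of_subset_of_mem fun F ⟨n, H, hF, hn, hk⟩ => ⟨_, ⟨n, H, rfl, hn, hk⟩, hF⟩

lemma mem_schreier_of_subset {F F' : Finset ℕ} (h : F ∈ schreier) (hF : F' ⊆ F) :
    F' ∈ schreier :=
  fun i hi => (Finset.card_le_card hF).trans (h i (hF hi))

lemma mem_domainFamily_of_subset {𝓖 : ℕ → Set (List ℕ)} {F F' : Finset ℕ}
    (h : F ∈ domainFamily 𝓖) (hF : F' ⊆ F) : F' ∈ domainFamily 𝓖 := by
  rcases h with h | ⟨n, H, h1, h2⟩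
  · exact Or.inl (mem_schreier_of_subset h hF)
  · exact Or.inr ⟨n, H, hF.trans h1, h2⟩

lemma singleton_mem_schreier (i : ℕ) : {i} ∈ schreier := by
  intro j _
  simp

/-- Bounded set functions on the finite subsets of `ℕ`, with the supremum norm. -/
abbrev SetFun : Type := lp (fun _ : Finset ℕ => ℝ) ⊤

lemma SetFun.abs_le_norm (z : SetFun) (F : Finset ℕ) : |z F| ≤ ‖z‖ :=
  lp.norm_apply_le_norm ENNReal.top_ne_zero z F

/-- The combinatorial space of a family `𝓕`: set functions vanishing off `𝓕`, additive on the
sets in `𝓕`, and with tails tending to zero. -/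
def combSpace (𝓕 : Set (Finset ℕ)) : Submodule ℝ SetFun where
  carrier := {z | (∀ F ∉ 𝓕, z F = 0) ∧ (∀ F ∈ 𝓕, z F = ∑ i ∈ F, z {i}) ∧
    ∀ ε > 0, ∃ N : ℕ, ∀ F : Finset ℕ, (∀ i ∈ F, N ≤ i) → |z F| ≤ ε}
  zero_mem' := ⟨by simp, by simp, fun ε hε => ⟨0, fun F _ => by simpa using hε.le⟩⟩
  add_mem' := by
    rintro a b ⟨ha1, ha2, ha3⟩ ⟨hb1, hb2, hb3⟩
    refine ⟨fun F hF => ?_, fun F hF => ?_, fun ε hε => ?_⟩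
    · simp [ha1 F hF, hb1 F hF]
    · simp [ha2 F hF, hb2 F hF, Finset.sum_add_distrib]
    · obtain ⟨N, hN⟩ := ha3 (ε / 2) (half_pos hε)
      obtain ⟨M, hM⟩ := hb3 (ε / 2) (half_pos hε)
      refine ⟨max N M, fun F hF => ?_⟩
      have h1 := hN F fun i hi => (le_max_left _ _).trans (hF i hi)
      have h2 := hM F fun i hi => (le_max_right _ _).trans (hF i hi)
      have h3 : |(a + b) F| ≤ |a F| + |b F| := by
        simpa using abs_add_le (a F) (b F)
      linarith
  smul_mem' := by
    rintro c a ⟨ha1, ha2, ha3⟩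
    refine ⟨fun F hF => ?_, fun F hF => ?_, fun ε hε => ?_⟩
    · simp [ha1 F hF]
    · simp [ha2 F hF, Finset.mul_sum]
    · obtain ⟨N, hN⟩ := ha3 (ε / (|c| + 1)) (by positivity)
      refine ⟨N, fun F hF => ?_⟩
      have h1 := hN F hF
      have h2 : |(c • a) F| = |c| * |a F| := by simp [abs_mul]
      rw [h2]
      calc |c| * |a F| ≤ (|c| + 1) * (ε / (|c| + 1)) := by gcongr; linarith
        _ = ε := by field_simp

lemma isClosed_combSpace (𝓕 : Set (Finset ℕ)) : IsClosed (combSpace 𝓕 : Set SetFun) := by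
  have hev : ∀ F : Finset ℕ, Continuous fun z : SetFun => z F := fun F =>
    (lp.evalCLM ℝ (fun _ : Finset ℕ => ℝ) ⊤ F).continuous
  have h1 : IsClosed {z : SetFun | ∀ F ∉ 𝓕, z F = 0} := by
    simp only [Set.ofPred_forall]
    exact isClosed_iInter fun F => isClosed_iInter fun _ => isClosed_eq (hev F) continuous_const
  have h2 : IsClosed {z : SetFun | ∀ F ∈ 𝓕, z F = ∑ i ∈ F, z {i}} := by
    simp only [Set.ofPred_forall]
    exact isClosed_iInter fun F => isClosed_iInter fun _ =>
      isClosed_eq (hev F) (continuous_finsetSum _ fun i _ => hev {i})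
  have h3 : IsClosed {z : SetFun | ∀ ε > 0, ∃ N : ℕ, ∀ F : Finset ℕ, (∀ i ∈ F, N ≤ i) →
      |z F| ≤ ε} := by
    refine isClosed_of_closure_subset fun z hz ε hε => ?_
    obtain ⟨w, hw, hzw⟩ := Metric.mem_closure_iff.1 hz (ε / 2) (half_pos hε)
    obtain ⟨N, hN⟩ := hw (ε / 2) (half_pos hε)
    refine ⟨N, fun F hF => ?_⟩
    have h := hN F hF
    have h' := SetFun.abs_le_norm (z - w) F
    rw [← dist_eq_norm] at h'
    have h'' : |z F| ≤ |w F| + |(z - w) F| := by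
      simpa using abs_add_le (w F) ((z - w) F)
    linarith
  exact h1.inter (h2.inter h3)

instance (𝓕 : Set (Finset ℕ)) : CompleteSpace (combSpace 𝓕) :=
  (isClosed_combSpace 𝓕).completeSpace_coe

namespace combSpace

variable {𝓕 : Set (Finset ℕ)}

lemma abs_le_norm (z : combSpace 𝓕) (F : Finset ℕ) : |z.1 F| ≤ ‖z‖ :=
  SetFun.abs_le_norm z.1 F

lemma norm_le_of_forall_mem (z : combSpace 𝓕) {C : ℝ} (hC : 0 ≤ C)
    (h : ∀ F ∈ 𝓕, |z.1 F| ≤ C) : ‖z‖ ≤ C := by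
  refine lp.norm_le_of_forall_le hC fun F => ?_
  by_cases hF : F ∈ 𝓕
  · exact h F hF
  · exact (congrArg norm (z.2.1 F hF)).trans_le (norm_zero.trans_le hC)

lemma apply_eq_sum (z : combSpace 𝓕) {F : Finset ℕ} (hF : F ∈ 𝓕) :
    z.1 F = ∑ i ∈ F, z.1 {i} :=
  z.2.2.1 F hF

lemma exists_tail_le (z : combSpace 𝓕) {ε : ℝ} (hε : 0 < ε) :
    ∃ N : ℕ, ∀ F : Finset ℕ, (∀ i ∈ F, N ≤ i) → |z.1 F| ≤ ε :=
  z.2.2.2 ε hε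

/-- Evaluation at a finite set. -/
noncomputable def eval (𝓕 : Set (Finset ℕ)) (F : Finset ℕ) : combSpace 𝓕 →L[ℝ] ℝ :=
  (lp.evalCLM ℝ (fun _ : Finset ℕ => ℝ) ⊤ F).comp (combSpace 𝓕).subtypeL

@[simp] lemma eval_apply (F : Finset ℕ) (z : combSpace 𝓕) : eval 𝓕 F z = z.1 F := rfl

open Classical in
/-- The unit vectors of a combinatorial space. -/
noncomputable def unit (h : ∀ i, {i} ∈ 𝓕) (n : ℕ) : combSpace 𝓕 :=
  ⟨⟨fun F => if F ∈ 𝓕 ∧ n ∈ F then 1 else 0, memℓp_infty ⟨1, by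
    rintro _ ⟨F, rfl⟩
    dsimp only
    split_ifs <;> simp⟩⟩, by
    refine ⟨fun F hF => ?_, fun F hF => ?_, fun ε hε => ⟨n + 1, fun F hF => ?_⟩⟩
    · simp [hF]
    · simp [hF, h, Finset.sum_ite_eq]
    · have : n ∉ F := fun hn => absurd (hF n hn) (by omega)
      simpa [this] using hε.le⟩

open Classical in
lemma unit_apply (h : ∀ i, {i} ∈ 𝓕) (n : ℕ) (F : Finset ℕ) :
    (unit h n).1 F = if F ∈ 𝓕 ∧ n ∈ F then 1 else 0 := rfl

lemma linearCombination_unit_apply (h : ∀ i, {i} ∈ 𝓕) (a : ℕ →₀ ℝ) {F : Finset ℕ}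
    (hF : F ∈ 𝓕) :
    (Finsupp.linearCombination ℝ (unit h) a).1 F = ∑ i ∈ F, a i := by
  classical
  rw [← eval_apply, Finsupp.linearCombination_apply, Finsupp.sum, map_sum]
  simp only [map_smul, eval_apply, unit_apply, hF, true_and, smul_eq_mul, mul_ite, mul_one,
    mul_zero]
  rw [← Finset.sum_filter]
  refine Finset.sum_subset (fun i hi => (Finset.mem_filter.1 hi).2) fun i hi hi' => ?_
  by_contra hne
  exact hi' (Finset.mem_filter.2 ⟨Finsupp.mem_support_iff.2 hne, hi⟩)

lemma frequently_lt_false (h : ∀ i, {i} ∈ 𝓕) (hflat : IsFlat 𝓕)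
    (f : combSpace 𝓕 →L[ℝ] ℝ) {ε : ℝ} (hε : 0 < ε) :
    ¬ ∃ᶠ n in atTop, ε ≤ f (unit h n) := by
  intro hfreq
  obtain ⟨a, ⟨ha0, ha1, haf⟩, haF⟩ := hflat
    {a | (∀ i, 0 ≤ a i) ∧ (∀ F : Finset ℕ, ∑ i ∈ F, a i ≤ 1) ∧
      ε ≤ f (Finsupp.linearCombination ℝ (unit h) a)}
    (by
      rintro a ⟨ha0, ha1, haf⟩ b ⟨hb0, hb1, hbf⟩ s t hs ht hst
      refine ⟨fun i => ?_, fun F => ?_, ?_⟩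
      · have := mul_nonneg hs (ha0 i)
        have := mul_nonneg ht (hb0 i)
        simp only [Finsupp.add_apply, Finsupp.smul_apply, smul_eq_mul]
        linarith
      · have h1 := mul_le_mul_of_nonneg_left (ha1 F) hs
        have h2 := mul_le_mul_of_nonneg_left (hb1 F) ht
        simp only [Finsupp.add_apply, Finsupp.smul_apply, smul_eq_mul,
          Finset.sum_add_distrib, ← Finset.mul_sum]
        linarith
      · have h1 := mul_le_mul_of_nonneg_left haf hs
        have h2 := mul_le_mul_of_nonneg_left hbf ht
        have h3 : s * ε + t * ε = ε := by rw [← add_mul, hst, one_mul]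
        simp only [map_add, map_smul, smul_eq_mul]
        linarith)
    (fun a ha => ⟨ha.1, ha.2.1⟩)
    (fun n => by
      classical
      obtain ⟨m, hm, hfm⟩ := (frequently_atTop.1 hfreq) n
      refine ⟨Finsupp.single m 1, ⟨fun i => ?_, fun F => ?_, by simpa using hfm⟩, fun i hi => ?_⟩
      · simp only [Finsupp.single_apply]
        split_ifs <;> norm_num
      · simp only [Finsupp.single_apply, Finset.sum_ite_eq]
        split_ifs <;> norm_num
      · rw [Finsupp.single_apply, if_neg (by omega)])
    (ε / (2 * (‖f‖ + 1))) (by positivity)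
  have hnorm : ‖Finsupp.linearCombination ℝ (unit h) a‖ ≤ ε / (2 * (‖f‖ + 1)) := by
    refine norm_le_of_forall_mem _ (by positivity) fun F hF => ?_
    rw [linearCombination_unit_apply h a hF, abs_of_nonneg (Finset.sum_nonneg fun i _ => ha0 i)]
    exact haF F hF
  have h1 : ε ≤ ‖f‖ * (ε / (2 * (‖f‖ + 1))) :=
    haf.trans ((le_abs_self _).trans ((f.le_opNorm _).trans (by gcongr)))
  have h2 : ‖f‖ * (ε / (2 * (‖f‖ + 1))) ≤ ε / 2 := by
    calc ‖f‖ * (ε / (2 * (‖f‖ + 1))) ≤ (‖f‖ + 1) * (ε / (2 * (‖f‖ + 1))) := by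
          gcongr; linarith
      _ = ε / 2 := by field_simp
  linarith

lemma weaklyNull_unit (h : ∀ i, {i} ∈ 𝓕) (hflat : IsFlat 𝓕) : WeaklyNull (unit h) := by
  intro f
  rw [Metric.tendsto_atTop']
  intro ε hε
  have h1 := not_frequently.1 (frequently_lt_false h hflat f hε)
  have h2 := not_frequently.1 (frequently_lt_false h hflat (-f) hε)
  obtain ⟨N, hN⟩ := eventually_atTop.1 (h1.and h2)
  refine ⟨N, fun n hn => ?_⟩
  obtain ⟨h3, h4⟩ := hN n hn.le
  rw [neg_apply] at h4
  rw [Real.dist_eq, sub_zero, abs_lt]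
  constructor <;> linarith

/-- The restriction operator to the Schreier sets. -/
noncomputable def restrict (𝓕 : Set (Finset ℕ)) :
    combSpace 𝓕 →L[ℝ] lp (fun _ : schreier => ℝ) ⊤ :=
  LinearMap.mkContinuous
    { toFun := fun z => ⟨fun F => z.1 F.1, memℓp_infty ⟨‖z‖, by
        rintro _ ⟨F, rfl⟩
        exact abs_le_norm z F.1⟩⟩
      map_add' := fun _ _ => rfl
      map_smul' := fun _ _ => rfl } 1 fun z => by
    rw [one_mul]
    exact lp.norm_le_of_forall_le (norm_nonneg _) fun F => abs_le_norm z F.1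

@[simp] lemma restrict_apply (z : combSpace 𝓕) (F : schreier) :
    restrict 𝓕 z F = z.1 F.1 := rfl

lemma sum_unit_apply (h : ∀ i, {i} ∈ 𝓕) {φ : ℕ → ℕ} (hφ : StrictMono φ) (N : ℕ)
    {F : Finset ℕ} (hF : F ∈ 𝓕) :
    (∑ k ∈ Finset.range N, (unit h (φ k)).1 F) = ((F ∩ (Finset.range N).image φ).card : ℝ) := by
  classical
  simp only [unit_apply, hF, true_and]
  rw [Finset.sum_boole, ← Finset.card_image_of_injective _ hφ.injective]
  congr 2
  ext i
  simp only [Finset.mem_image, Finset.mem_filter, Finset.mem_inter]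
  constructor
  · rintro ⟨k, ⟨h1, h2⟩, rfl⟩
    exact ⟨h2, k, h1, rfl⟩
  · rintro ⟨h2, k, h1, rfl⟩
    exact ⟨k, ⟨h1, h2⟩, rfl⟩

lemma mean_restrict_apply (x : ℕ → combSpace 𝓕) (N : ℕ) (F : schreier) :
    ((N : ℝ)⁻¹ • ∑ k ∈ Finset.range N, restrict 𝓕 (x k)) F
      = (N : ℝ)⁻¹ * ∑ k ∈ Finset.range N, (x k).1 F.1 := by
  have h := map_smul (lp.evalCLM ℝ (fun _ : schreier => ℝ) ⊤ F) (N : ℝ)⁻¹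
    (∑ k ∈ Finset.range N, restrict 𝓕 (x k))
  rw [map_sum] at h
  exact h

lemma not_weakBanachSaks_restrict (hsub : schreier ⊆ 𝓕) (hflat : IsFlat 𝓕) :
    ¬ WeakBanachSaks (restrict 𝓕) := by
  classical
  have h : ∀ i, {i} ∈ 𝓕 := fun i => hsub (singleton_mem_schreier i)
  intro hBS
  obtain ⟨φ, hφ, y, hy⟩ := hBS (unit h) (weaklyNull_unit h hflat)
  have hval : ∀ (N : ℕ) (F : schreier),
      ((N : ℝ)⁻¹ • ∑ k ∈ Finset.range N, restrict 𝓕 (unit h (φ k))) F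
        = (N : ℝ)⁻¹ * ((F.1 ∩ (Finset.range N).image φ).card : ℝ) := fun N F => by
    rw [mean_restrict_apply (fun k => unit h (φ k)), sum_unit_apply h hφ N (hsub F.2)]
  have hy0 : y = 0 := by
    ext F
    have h1 := ((lp.evalCLM ℝ (fun _ : schreier => ℝ) ⊤ F).continuous.tendsto y).comp hy
    have h2 : Tendsto (fun N : ℕ => (N : ℝ)⁻¹ * (F.1.card : ℝ)) atTop (nhds 0) := by
      simpa using tendsto_inv_atTop_nhds_zero_nat.mul_const (F.1.card : ℝ)
    refine tendsto_nhds_unique h1 (squeeze_zero (fun N => ?_) (fun N => ?_) h2)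
    · refine le_of_le_of_eq ?_ (hval N F).symm
      positivity
    · refine (hval N F).le.trans ?_
      gcongr
      exact Finset.inter_subset_left
  subst hy0
  obtain ⟨N, hN⟩ := Metric.tendsto_atTop.1 hy (1 / 2) (by norm_num)
  have hN' := hN (2 * (N + 1)) (by omega)
  rw [dist_zero_right] at hN'
  set F₀ : Finset ℕ := (Finset.Ico (N + 1) (2 * (N + 1))).image φ with hF₀
  have hcard : F₀.card = N + 1 := by
    rw [hF₀, Finset.card_image_of_injective _ hφ.injective, Nat.card_Ico]
    omega
  have hF₀s : F₀ ∈ schreier := by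
    intro i hi
    obtain ⟨k, hk, rfl⟩ := Finset.mem_image.1 hi
    have h1 := (Finset.mem_Ico.1 hk).1
    have h2 := hφ.id_le k
    simp only [id] at h2
    omega
  have h1 := lp.norm_apply_le_norm ENNReal.top_ne_zero
    (((2 * (N + 1) : ℕ) : ℝ)⁻¹ • ∑ k ∈ Finset.range (2 * (N + 1)), restrict 𝓕 (unit h (φ k)))
    (⟨F₀, hF₀s⟩ : schreier)
  have h2 : F₀ ∩ (Finset.range (2 * (N + 1))).image φ = F₀ :=
    Finset.inter_eq_left.2 (Finset.image_subset_image fun i hi =>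
      Finset.mem_range.2 (Finset.mem_Ico.1 hi).2)
  rw [hval] at h1
  simp only [h2, hcard] at h1
  have h3 : (((2 * (N + 1) : ℕ) : ℝ)⁻¹ * ((N + 1 : ℕ) : ℝ)) = 1 / 2 := by
    push_cast
    field_simp
  rw [h3, Real.norm_eq_abs, abs_of_pos (by norm_num)] at h1
  linarith

end combSpace

section Sequences

variable {X : Type*} [NormedAddCommGroup X] [NormedSpace ℝ X]

lemma WeaklyNull.map {Y : Type*} [NormedAddCommGroup Y] [NormedSpace ℝ Y] {x : ℕ → X}
    (hx : WeaklyNull x) (C : X →L[ℝ] Y) : WeaklyNull fun n => C (x n) :=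
  fun f => hx (f.comp C)

lemma WeaklyNull.exists_norm_le {x : ℕ → X} (hx : WeaklyNull x) :
    ∃ B, ∀ n, ‖x n‖ ≤ B := by
  obtain ⟨B, hB⟩ := banach_steinhaus
    (g := fun n => NormedSpace.inclusionInDoubleDualLi ℝ (x n)) fun f => by
      obtain ⟨C, hC⟩ := (hx f).norm.bddAbove_range
      exact ⟨C, fun n => hC ⟨n, rfl⟩⟩
  exact ⟨B, fun n => (LinearIsometry.norm_map _ _).symm.trans_le (hB n)⟩

/-- The tree of finite increasing sequences of indices (last entry first) along which all convex
combinations of `x` have norm at least `c`. -/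
def normTree (x : ℕ → X) (c : ℝ) : Set (List ℕ) :=
  {s | s.Pairwise (· > ·) ∧ ∀ y ∈ convexHull ℝ (x '' {m | m ∈ s}), c ≤ ‖y‖}

lemma wellFounded_normTree {x : ℕ → X} (hx : WeaklyNull x) {c : ℝ} (hc : 0 < c) :
    WellFounded fun t s : List ℕ => ∃ m, t = m :: s ∧ t ∈ normTree x c := by
  rw [wellFounded_iff_isEmpty_descending_chain]
  refine ⟨fun ⟨s, hs⟩ => ?_⟩
  choose m hm hmem using hs
  have hlt : StrictMono m := strictMono_nat_of_lt_succ fun n => by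
    have h1 := (hmem (n + 1)).1
    rw [hm (n + 1)] at h1
    exact (List.pairwise_cons.1 h1).1 (m n) (by rw [hm n]; exact List.mem_cons_self)
  have hmono : Monotone fun n => convexHull ℝ (x '' {i | i ∈ s (n + 1)}) := by
    refine monotone_nat_of_le_succ fun n => convexHull_mono (Set.image_mono fun i hi => ?_)
    change i ∈ s (n + 1 + 1)
    rw [hm (n + 1)]
    exact List.mem_cons_of_mem _ hi
  have hconv : Convex ℝ (⋃ n, convexHull ℝ (x '' {i | i ∈ s (n + 1)})) :=
    Directed.convex_iUnion hmono.directed_le fun n => convex_convexHull ℝ _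
  obtain ⟨f, u, hf1, hf2⟩ := geometric_hahn_banach_open (convex_ball (0 : X) c)
    Metric.isOpen_ball hconv (Set.disjoint_left.2 fun y hy hy' => by
      obtain ⟨n, hn⟩ := Set.mem_iUnion.1 hy'
      have := (hmem n).2 y hn
      rw [mem_ball_zero_iff] at hy
      linarith)
  have h0 : 0 < u := by simpa using hf1 0 (Metric.mem_ball_self hc)
  have h1 : Tendsto (fun n => f (x (m n))) atTop (nhds 0) := (hx f).comp hlt.tendsto_atTop
  have h2 : u ≤ 0 := ge_of_tendsto' h1 fun n => hf2 _ (Set.mem_iUnion.2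
    ⟨n, subset_convexHull ℝ _ ⟨m n, by
      change m n ∈ s (n + 1)
      rw [hm n]
      exact List.mem_cons_self, rfl⟩⟩)
  linarith

end Sequences

/-- If at each position of an increasing sequence of thresholds the terms `r j` are small except
possibly for the single `j` whose window contains `μ`, then the sums of `|r j|` are bounded. -/
lemma sum_le_of_window {r : ℕ → ℝ} {T : ℕ → ℕ} (hT : Monotone T) {B : ℝ} (hB : 0 ≤ B) (μ : ℕ)
    (h1 : ∀ j, μ < T j → |r j| ≤ (1 / 2) ^ j) (h2 : ∀ j, T (j + 1) ≤ μ → |r j| ≤ (1 / 2) ^ j)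
    (h3 : ∀ j, |r j| ≤ B) (N : ℕ) : |∑ j ∈ Finset.range N, r j| ≤ 2 + B := by
  classical
  have hterm : ∀ j, |r j| ≤ (1 / 2) ^ j + if T j ≤ μ ∧ μ < T (j + 1) then B else 0 := by
    intro j
    have hp : (0 : ℝ) ≤ (1 / 2) ^ j := by positivity
    split_ifs with h
    · linarith [h3 j]
    · rw [add_zero]
      by_cases h' : T j ≤ μ
      · exact h2 j (not_lt.1 fun h'' => h ⟨h', h''⟩)
      · exact h1 j (not_le.1 h')
  have hgeom : ∑ j ∈ Finset.range N, (1 / 2 : ℝ) ^ j ≤ 2 :=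
    (summable_geometric_two.sum_le_tsum _ fun i _ => by positivity).trans_eq tsum_geometric_two
  have hone : ∑ j ∈ Finset.range N, (if T j ≤ μ ∧ μ < T (j + 1) then B else 0) ≤ B := by
    rw [← Finset.sum_filter, Finset.sum_const, nsmul_eq_mul]
    have : ((Finset.range N).filter fun j => T j ≤ μ ∧ μ < T (j + 1)).card ≤ 1 := by
      refine Finset.card_le_one.2 fun a ha b hb => ?_
      obtain ⟨-, ha1, ha2⟩ := Finset.mem_filter.1 ha
      obtain ⟨-, hb1, hb2⟩ := Finset.mem_filter.1 hb
      rcases lt_trichotomy a b with h | h | h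
      · have := hT (show a + 1 ≤ b from h)
        omega
      · exact h
      · have := hT (show b + 1 ≤ a from h)
        omega
    have h4 : (((Finset.range N).filter fun j => T j ≤ μ ∧ μ < T (j + 1)).card : ℝ) ≤ 1 := by
      exact_mod_cast this
    nlinarith
  calc |∑ j ∈ Finset.range N, r j| ≤ ∑ j ∈ Finset.range N, |r j| :=
        Finset.abs_sum_le_sum_abs _ _
    _ ≤ ∑ j ∈ Finset.range N, ((1 / 2) ^ j + if T j ≤ μ ∧ μ < T (j + 1) then B else 0) :=
        Finset.sum_le_sum fun j _ => hterm j
    _ ≤ 2 + B := by rw [Finset.sum_add_distrib]; linarith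

namespace combSpace

variable {𝓕 : Set (Finset ℕ)}

lemma exists_bounded_sums (hsub : schreier ⊆ 𝓕) {z : ℕ → combSpace 𝓕} {B : ℝ}
    (hB : ∀ n, ‖z n‖ ≤ B)
    (hsmall : ∀ δ > 0, ∀ n₀ : ℕ, ∃ n, n₀ < n ∧ ∀ i : ℕ, |(z n).1 {i}| ≤ δ) :
    ∃ φ : ℕ → ℕ, StrictMono φ ∧
      ∀ N, ∀ F ∈ schreier, |∑ k ∈ Finset.range N, (z (φ k)).1 F| ≤ 2 + B := by
  have hB0 : 0 ≤ B := (norm_nonneg _).trans (hB 0)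
  have step : ∀ j p T : ℕ, ∃ n T' : ℕ, p < n ∧ T ≤ T' ∧
      (∀ i : ℕ, |(z n).1 {i}| ≤ (1 / 2) ^ j / (T + 1)) ∧
      ∀ F : Finset ℕ, (∀ i ∈ F, T' ≤ i) → |(z n).1 F| ≤ (1 / 2) ^ j := by
    intro j p T
    obtain ⟨n, hpn, hn⟩ := hsmall ((1 / 2) ^ j / (T + 1)) (by positivity) p
    obtain ⟨M, hM⟩ := exists_tail_le (z n) (show (0 : ℝ) < (1 / 2) ^ j by positivity)
    exact ⟨n, max T M, hpn, le_max_left _ _, hn,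
      fun F hF => hM F fun i hi => (le_max_right _ _).trans (hF i hi)⟩
  choose n T' hpn hTT' hcoord htail using step
  let s : ℕ → ℕ × ℕ := fun k =>
    Nat.rec (0, 0) (fun j q => (n j q.1 q.2, T' j q.1 q.2)) k
  have hs : ∀ j, s (j + 1) = (n j (s j).1 (s j).2, T' j (s j).1 (s j).2) := fun _ => rfl
  have hT : Monotone fun j => (s j).2 := monotone_nat_of_le_succ fun j => by
    rw [hs]
    exact hTT' _ _ _
  refine ⟨fun j => (s (j + 1)).1, strictMono_nat_of_lt_succ fun j => ?_, fun N F hF => ?_⟩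
  · rw [hs (j + 1)]
    exact hpn _ _ _
  · have h3 : ∀ j, |(z (s (j + 1)).1).1 F| ≤ B := fun j => (abs_le_norm _ _).trans (hB _)
    rcases F.eq_empty_or_nonempty with rfl | hne
    · have : ∀ k, (z k).1 ∅ = 0 := fun k => by
        rw [apply_eq_sum _ (hsub hF), Finset.sum_empty]
      simp only [this, Finset.sum_const_zero, abs_zero]
      linarith
    refine sum_le_of_window hT hB0 (F.min' hne) (fun j hj => ?_) (fun j hj => ?_) h3 N
    · rw [hs, apply_eq_sum _ (hsub hF)]
      have hcard : (F.card : ℝ) ≤ (s j).2 + 1 := by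
        have := hF _ (F.min'_mem hne)
        have h : F.card ≤ (s j).2 + 1 := by
          change F.min' hne < (s j).2 at hj
          omega
        exact_mod_cast h
      calc |∑ i ∈ F, (z (n j (s j).1 (s j).2)).1 {i}|
          ≤ ∑ i ∈ F, |(z (n j (s j).1 (s j).2)).1 {i}| := Finset.abs_sum_le_sum_abs _ _
        _ ≤ ∑ i ∈ F, (1 / 2 : ℝ) ^ j / ((s j).2 + 1) :=
            Finset.sum_le_sum fun i _ => hcoord _ _ _ i
        _ = F.card * ((1 / 2 : ℝ) ^ j / ((s j).2 + 1)) := by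
            rw [Finset.sum_const, nsmul_eq_mul]
        _ ≤ ((s j).2 + 1) * ((1 / 2 : ℝ) ^ j / ((s j).2 + 1)) := by gcongr
        _ = (1 / 2) ^ j := by field_simp
    · rw [hs]
      exact htail _ _ _ F fun i hi => hj.trans (F.min'_le i hi)

lemma exists_means_restrict_tendsto_zero (hsub : schreier ⊆ 𝓕) {z : ℕ → combSpace 𝓕} {B : ℝ}
    (hB : ∀ n, ‖z n‖ ≤ B)
    (hsmall : ∀ δ > 0, ∀ n₀ : ℕ, ∃ n, n₀ < n ∧ ∀ i : ℕ, |(z n).1 {i}| ≤ δ) :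
    ∃ φ : ℕ → ℕ, StrictMono φ ∧
      Tendsto (fun N : ℕ => (N : ℝ)⁻¹ • ∑ k ∈ Finset.range N, restrict 𝓕 (z (φ k)))
        atTop (nhds 0) := by
  obtain ⟨φ, hφ, hsum⟩ := exists_bounded_sums hsub hB hsmall
  have hB0 : 0 ≤ B := (norm_nonneg _).trans (hB 0)
  refine ⟨φ, hφ, squeeze_zero_norm (a := fun N : ℕ => (N : ℝ)⁻¹ * (2 + B)) (fun N => ?_) ?_⟩
  · refine lp.norm_le_of_forall_le (by positivity) fun F => ?_
    rw [mean_restrict_apply fun k => z (φ k), norm_mul, Real.norm_eq_abs,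
      abs_of_nonneg (by positivity : (0 : ℝ) ≤ (N : ℝ)⁻¹)]
    exact mul_le_mul_of_nonneg_left (hsum N F.1 F.2) (by positivity)
  · simpa using tendsto_inv_atTop_nhds_zero_nat.mul_const (2 + B)

end combSpace

lemma spread_of_chain {𝓖 : Set (List ℕ)} {m i : ℕ → ℕ} {s : ℕ → List ℕ}
    (hs : ∀ l, s (l + 1) = m l :: s l) (hi : StrictMono i) (hmi : ∀ l, m l ≤ i (l + 1)) (d : ℕ) :
    ∀ l, (∀ l' ≤ l + d, s l' ∈ 𝓖) →
      Spread 𝓖 (s l) ((Finset.Ico (l + 1) (l + d + 1)).image i) := by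
  induction d with
  | zero =>
    intro l _
    simpa using Spread.empty (s l)
  | succ d ih =>
    intro l h
    have h1 : Finset.Ico (l + 1) (l + (d + 1) + 1)
        = insert (l + 1) (Finset.Ico (l + 1 + 1) (l + 1 + d + 1)) := by
      ext t
      simp only [Finset.mem_Ico, Finset.mem_insert]
      omega
    rw [h1, Finset.image_insert]
    refine Spread.insert _ (m l) _ _ (hmi l) (fun t ht => ?_) ?_ ?_
    · obtain ⟨t', ht', rfl⟩ := Finset.mem_image.1 ht
      exact hi (Finset.mem_Ico.1 ht').1
    · rw [← hs]
      exact h _ (by omega)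
    · rw [← hs]
      exact ih (l + 1) fun l' hl' => h l' (by omega)

lemma image_range_mem_domainFamily {𝓖 : ℕ → Set (List ℕ)} {m i : ℕ → ℕ} {s : ℕ → List ℕ}
    (hs₀ : s 0 = []) (hs : ∀ l, s (l + 1) = m l :: s l) (hi : StrictMono i)
    (hmi : ∀ l, m l ≤ i (l + 1)) {k L : ℕ} (hk : k ≤ i 0) (h : ∀ l ≤ L, s l ∈ 𝓖 k) :
    (Finset.range (L + 1)).image i ∈ domainFamily 𝓖 := by
  refine Or.inr ⟨i 0, (Finset.Ico (0 + 1) (0 + L + 1)).image i, ?_, fun t ht => ?_, k, hk, ?_⟩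
  · rw [← Finset.image_insert]
    refine Finset.image_subset_image fun t ht => ?_
    simp only [Finset.mem_range, Finset.mem_insert, Finset.mem_Ico] at ht ⊢
    omega
  · obtain ⟨t', ht', rfl⟩ := Finset.mem_image.1 ht
    exact hi (Finset.mem_Ico.1 ht').1
  · rw [← hs₀]
    exact spread_of_chain hs hi hmi L 0 fun l hl => h l (by omega)

namespace combSpace

variable {𝓕 : Set (Finset ℕ)}

/-- A gliding hump: along a subsequence, `z (m l)` is almost concentrated at the coordinate
`j (m l)` as far as the coordinates `j (m l')` are concerned. -/
lemma exists_almost_disjoint (hher : ∀ F ∈ 𝓕, ∀ F' ⊆ F, F' ∈ 𝓕) {z : ℕ → combSpace 𝓕}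
    (hz : WeaklyNull z) {δ : ℝ} (hδ : 0 < δ) {n₀ : ℕ} {j : ℕ → ℕ}
    (hj : ∀ n, n₀ < n → δ < |(z n).1 {j n}|) {η : ℝ} (hη : 0 < η) (k : ℕ) :
    ∃ m : ℕ → ℕ, StrictMono m ∧ StrictMono (fun l => j (m l)) ∧ k ≤ j (m 0) ∧
      (∀ l, m l ≤ j (m (l + 1))) ∧ (∀ l, n₀ < m l) ∧
      ∀ l, ∀ F ∈ 𝓕, (∀ i ∈ F, ∃ l', l' ≠ l ∧ i = j (m l')) → |(z (m l)).1 F| ≤ 3 * η := by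
  classical
  have hcoord : ∀ i : ℕ, ∀ ε > 0, ∀ᶠ n in atTop, |(z n).1 {i}| ≤ ε := fun i ε hε => by
    filter_upwards [(hz (eval 𝓕 {i})).eventually (Metric.ball_mem_nhds 0 hε)] with n hn
    rw [dist_zero_right] at hn
    exact hn.le
  have hjlarge : ∀ M : ℕ, ∀ᶠ n in atTop, M ≤ j n := fun M => by
    have h1 : ∀ᶠ n in atTop, ∀ i ∈ Finset.range M, |(z n).1 {i}| ≤ δ :=
      (Filter.eventually_all_finset _).2 fun i _ => hcoord i δ hδ
    filter_upwards [h1, eventually_gt_atTop n₀] with n hn hn₀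
    by_contra hlt
    exact absurd (hn (j n) (Finset.mem_range.2 (not_le.1 hlt))) (not_le.2 (hj n hn₀))
  choose t ht using fun n => exists_tail_le (z n) hη
  obtain ⟨m, hm1, hm2⟩ := exists_seq_of_forall_finset_exists (fun n => n₀ < n ∧ k ≤ j n)
    (fun a b => a < b ∧ a ≤ j b ∧ j a < j b ∧ t a ≤ j b ∧
      |(z b).1 {j a}| ≤ η * (1 / 2) ^ (j a)) fun S _ => by
    have h1 : ∀ᶠ n in atTop, ∀ a ∈ S, a < n ∧ a ≤ j n ∧ j a < j n ∧ t a ≤ j n ∧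
        |(z n).1 {j a}| ≤ η * (1 / 2) ^ (j a) :=
      (Filter.eventually_all_finset _).2 fun a _ => by
        filter_upwards [eventually_gt_atTop a, hjlarge a, hjlarge (j a + 1), hjlarge (t a),
          hcoord (j a) (η * (1 / 2) ^ (j a)) (by positivity)] with n h1 h2 h3 h4 h5
        exact ⟨h1, h2, h3, h4, h5⟩
    obtain ⟨y, h2, h3, h4⟩ := (h1.and ((eventually_gt_atTop n₀).and (hjlarge k))).exists
    exact ⟨y, ⟨h3, h4⟩, h2⟩
  have hjm : StrictMono fun l => j (m l) := fun a b hab => (hm2 a b hab).2.2.1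
  refine ⟨m, fun a b hab => (hm2 a b hab).1, hjm, (hm1 0).2,
    fun l => (hm2 l (l + 1) (Nat.lt_succ_self l)).2.1, fun l => (hm1 l).1, fun l F hF hFl => ?_⟩
  have hsplit := Finset.sum_filter_add_sum_filter_not F (fun i => i < j (m l))
    fun i => (z (m l)).1 {i}
  rw [← apply_eq_sum _ hF] at hsplit
  have hbelow : |∑ i ∈ F with i < j (m l), (z (m l)).1 {i}| ≤ 2 * η := by
    calc |∑ i ∈ F with i < j (m l), (z (m l)).1 {i}|
        ≤ ∑ i ∈ F with i < j (m l), |(z (m l)).1 {i}| := Finset.abs_sum_le_sum_abs _ _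
      _ ≤ ∑ i ∈ F with i < j (m l), η * (1 / 2) ^ i := Finset.sum_le_sum fun i hi => by
          obtain ⟨hiF, hil⟩ := Finset.mem_filter.1 hi
          obtain ⟨l', -, rfl⟩ := hFl i hiF
          exact (hm2 l' l (hjm.lt_iff_lt.1 hil)).2.2.2.2
      _ ≤ η * 2 := by
          rw [← Finset.mul_sum]
          gcongr
          exact (summable_geometric_two.sum_le_tsum _ fun i _ => by positivity).trans_eq
            tsum_geometric_two
      _ = 2 * η := mul_comm _ _
  have habove : |∑ i ∈ F with ¬ i < j (m l), (z (m l)).1 {i}| ≤ η := by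
    rw [← apply_eq_sum _ (hher F hF _ (Finset.filter_subset _ _))]
    refine ht _ _ fun i hi => ?_
    obtain ⟨hiF, hil⟩ := Finset.mem_filter.1 hi
    obtain ⟨l', hl', rfl⟩ := hFl i hiF
    refine (hm2 l l' (lt_of_le_of_ne ?_ hl'.symm)).2.2.2.1
    exact hjm.le_iff_le.1 (not_lt.1 hil)
  rw [← hsplit]
  exact (abs_add_le _ _).trans (by linarith)

lemma exists_functional (hher : ∀ F ∈ 𝓕, ∀ F' ⊆ F, F' ∈ 𝓕) {z : ℕ → combSpace 𝓕} {i : ℕ → ℕ}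
    (hi : Function.Injective i) {δ : ℝ} (hδ : ∀ l, δ ≤ |(z l).1 {i l}|)
    (hoff : ∀ l, ∀ F ∈ 𝓕, (∀ t ∈ F, ∃ l', l' ≠ l ∧ t = i l') → |(z l).1 F| ≤ δ / 4) {L : ℕ}
    (hL : (Finset.range (L + 1)).image i ∈ 𝓕) :
    ∃ f : combSpace 𝓕 →L[ℝ] ℝ, (∀ w, f w ≤ 2 * ‖w‖) ∧ ∀ l ≤ L, δ / 2 ≤ f (z l) := by
  classical
  set P := (Finset.range (L + 1)).filter fun l => 0 ≤ (z l).1 {i l} with hP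
  set Q := (Finset.range (L + 1)).filter fun l => ¬ 0 ≤ (z l).1 {i l} with hQ
  have hPF : P.image i ∈ 𝓕 := hher _ hL _ (Finset.image_subset_image (Finset.filter_subset _ _))
  have hQF : Q.image i ∈ 𝓕 := hher _ hL _ (Finset.image_subset_image (Finset.filter_subset _ _))
  have hout : ∀ A : Finset ℕ, A.image i ∈ 𝓕 → ∀ l ∉ A, |(z l).1 (A.image i)| ≤ δ / 4 :=
    fun A hA l hl => hoff l _ hA fun t ht => by
      obtain ⟨l', hl', rfl⟩ := Finset.mem_image.1 ht
      exact ⟨l', fun h => hl (h ▸ hl'), rfl⟩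
  have hin : ∀ A : Finset ℕ, A.image i ∈ 𝓕 → ∀ l ∈ A,
      |(z l).1 (A.image i) - (z l).1 {i l}| ≤ δ / 4 := fun A hA l hl => by
    have h1 : (A.erase l).image i ∈ 𝓕 :=
      hher _ hA _ (Finset.image_subset_image (Finset.erase_subset _ _))
    have h2 : (z l).1 (A.image i) - (z l).1 {i l} = (z l).1 ((A.erase l).image i) := by
      rw [apply_eq_sum _ hA, apply_eq_sum _ h1, Finset.sum_image hi.injOn,
        Finset.sum_image hi.injOn, ← Finset.add_sum_erase A _ hl, add_sub_cancel_left]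
    rw [h2]
    exact hout _ h1 l (Finset.notMem_erase l A)
  refine ⟨eval 𝓕 (P.image i) - eval 𝓕 (Q.image i), fun w => ?_, fun l hl => ?_⟩
  · have h1 := abs_le.1 (abs_le_norm w (P.image i))
    have h2 := abs_le.1 (abs_le_norm w (Q.image i))
    simp only [sub_apply, eval_apply]
    linarith
  · simp only [sub_apply, eval_apply]
    have hlr : l ∈ Finset.range (L + 1) := Finset.mem_range.2 (by omega)
    by_cases h : 0 ≤ (z l).1 {i l}
    · have h1 := abs_le.1 (hin P hPF l (Finset.mem_filter.2 ⟨hlr, h⟩))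
      have h2 := abs_le.1 (hout Q hQF l fun hl' => (Finset.mem_filter.1 hl').2 h)
      have h3 := hδ l
      rw [abs_of_nonneg h] at h3
      linarith
    · have h1 := abs_le.1 (hin Q hQF l (Finset.mem_filter.2 ⟨hlr, h⟩))
      have h2 := abs_le.1 (hout P hPF l fun hl' => h (Finset.mem_filter.1 hl').2)
      have h3 := hδ l
      rw [abs_of_neg (not_le.1 h)] at h3
      linarith

end combSpace

section Main

variable {X : Type*} [NormedAddCommGroup X] [NormedSpace ℝ X]

/-- The family of finite sets attached to a sequence in a normed space: it is richer than all
the trees of indices along which the sequence has uniform lower estimates. -/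
def seqFamily (x : ℕ → X) : Set (Finset ℕ) :=
  domainFamily fun k => normTree x (1 / ((k : ℝ) + 1))

lemma schreier_subset_seqFamily (x : ℕ → X) : schreier ⊆ seqFamily x :=
  Set.subset_union_left

lemma isFlat_seqFamily {x : ℕ → X} (hx : WeaklyNull x) : IsFlat (seqFamily x) :=
  isFlat_domainFamily fun _ => wellFounded_normTree hx (by positivity)

/-- The coordinates of the image of a weakly null sequence `x` in the combinatorial space of
`seqFamily x` become uniformly small infinitely often. -/
lemma exists_coord_small {x : ℕ → X} (hx : WeaklyNull x)
    (C : X →L[ℝ] combSpace (seqFamily x)) {δ : ℝ} (hδ : 0 < δ) (n₀ : ℕ) :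
    ∃ n, n₀ < n ∧ ∀ i : ℕ, |(C (x n)).1 {i}| ≤ δ := by
  by_contra! hcon
  choose! j hj using hcon
  have hher : ∀ F ∈ seqFamily x, ∀ F' ⊆ F, F' ∈ seqFamily x :=
    fun F hF F' hF' => mem_domainFamily_of_subset hF hF'
  obtain ⟨k, hk⟩ := exists_nat_gt (4 * (‖C‖ + 1) / δ)
  obtain ⟨m, hm, hjm, hk0, hmj, hn₀, hoff⟩ := combSpace.exists_almost_disjoint hher (hx.map C) hδ
    hj (η := δ / 12) (by positivity) k
  let s : ℕ → List ℕ := fun l => Nat.rec [] (fun l t => m l :: t) l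
  have hs : ∀ l, s (l + 1) = m l :: s l := fun _ => rfl
  have hsmem : ∀ l, ∀ a ∈ s l, ∃ l' < l, a = m l' := by
    intro l
    induction l with
    | zero => intro a ha; simp [s] at ha
    | succ l ih =>
      intro a ha
      rw [hs, List.mem_cons] at ha
      rcases ha with rfl | ha
      · exact ⟨l, Nat.lt_succ_self l, rfl⟩
      · obtain ⟨l', hl', rfl⟩ := ih a ha
        exact ⟨l', by omega, rfl⟩
  have hspair : ∀ l, (s l).Pairwise (· > ·) := by
    intro l
    induction l with
    | zero => exact List.Pairwise.nil
    | succ l ih =>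
      rw [hs]
      refine List.pairwise_cons.2 ⟨fun a ha => ?_, ih⟩
      obtain ⟨l', hl', rfl⟩ := hsmem l a ha
      exact hm hl'
  have hmem : ∀ l, s l ∈ normTree x (1 / ((k : ℝ) + 1)) := by
    intro l
    induction l using Nat.strong_induction_on with
    | _ l ih =>
      refine ⟨hspair l, fun y hy => ?_⟩
      rcases l with _ | L
      · simp [s] at hy
      · have hL : (Finset.range (L + 1)).image (fun l => j (m l)) ∈ seqFamily x :=
          image_range_mem_domainFamily (s := s) (k := k) rfl hs hjm hmj hk0
            fun l hl => ih l (by omega)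
        obtain ⟨f, hf1, hf2⟩ := combSpace.exists_functional hher (z := fun l => C (x (m l)))
          hjm.injective (fun l => (hj _ (hn₀ l)).le)
          (fun l F hF h => (hoff l F hF h).trans_eq (by ring)) hL
        have hconv : Convex ℝ {y : X | δ / 2 ≤ f (C y)} :=
          convex_halfSpace_ge (f.comp C).isBoundedLinearMap.toIsLinearMap _
        have hy' : δ / 2 ≤ f (C y) := convexHull_min (by
          rintro _ ⟨a, ha, rfl⟩
          obtain ⟨l', hl', rfl⟩ := hsmem (L + 1) a ha
          exact hf2 l' (by omega)) hconv hy
        have h1 : δ / 2 ≤ 2 * ((‖C‖ + 1) * ‖y‖) := by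
          have h2 := C.le_opNorm y
          have h3 := hf1 (C y)
          have h4 := norm_nonneg y
          nlinarith
        rw [div_lt_iff₀ hδ] at hk
        rw [div_le_iff₀ (by positivity)]
        have hC : 0 < 4 * (‖C‖ + 1) := by positivity
        have h5 : 4 * (‖C‖ + 1) * 1 ≤ 4 * (‖C‖ + 1) * (‖y‖ * (k + 1)) := by
          have h6 : (k + 1 : ℝ) * δ ≤ (k + 1) * (4 * (‖C‖ + 1) * ‖y‖) := by
            gcongr
            linarith
          nlinarith
        exact le_of_mul_le_mul_left h5 hC
  exact (wellFounded_iff_isEmpty_descending_chain.1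
    (wellFounded_normTree hx (c := 1 / ((k : ℝ) + 1)) (by positivity))).false
    ⟨s, fun n => ⟨m n, hs n, hmem (n + 1)⟩⟩

end Main

theorem statement6 :
    ¬ ∃ (E F : BanachSp) (U : E.carrier →L[ℝ] F.carrier),
      ¬ WeakBanachSaks U ∧
        ∀ (Z W : BanachSp) (T : Z.carrier →L[ℝ] W.carrier),
          ¬ WeakBanachSaks T → FactorsThrough U T := by
  rintro ⟨E, F, U, hU, hfac⟩
  apply hU
  intro x hx
  have hsub := schreier_subset_seqFamily x
  obtain ⟨C, D, hCD⟩ := hfac ⟨combSpace (seqFamily x)⟩ ⟨lp (fun _ : schreier => ℝ) ⊤⟩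
    (combSpace.restrict (seqFamily x))
    (combSpace.not_weakBanachSaks_restrict hsub (isFlat_seqFamily hx))
  obtain ⟨B, hB⟩ := (hx.map C).exists_norm_le
  obtain ⟨φ, hφ, hlim⟩ := combSpace.exists_means_restrict_tendsto_zero hsub hB
    fun δ hδ n₀ => exists_coord_small hx C hδ n₀
  refine ⟨φ, hφ, D 0, ((D.continuous.tendsto 0).comp hlim).congr fun N => ?_⟩
  simp only [Function.comp_apply, map_smul, map_sum]
  congr 1
  exact Finset.sum_congr rfl fun k _ => hCD _
end
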